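/- Let R be a commutative Noetherian ring, 𝔞 an ideal of R, and M an R-module such that the local cohomology module H^i_𝔞(M) is an FD_{<2} R-module for all i ≥ 0. Then the following are equivalent: (i) Ext^i_R(R/𝔞, M) is a finitely generated R-module for all i ≥ 0; (ii) H^i_𝔞(M) is 𝔞-cofinite for all i ≥ 0. -/

import Mathlib

universe u

open CategoryTheory

/-- The `i`-th Ext module `Ext^i_R(N, M)`. -/
noncomputable def extModule (R : Type u) [CommRing R] (N M : Type u)
    [AddCommGroup N] [Module R N] [AddCommGroup M] [Module R M] (i : ℕ) :
    ModuleCat.{u} R :=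
  ((Ext R (ModuleCat.{u} R) i).obj (Opposite.op (ModuleCat.of R N))).obj (ModuleCat.of R M)

/-- The `i`-th local cohomology module `H^i_𝔞(M)`. -/
noncomputable def localCohomologyModule (R : Type u) [CommRing R] (𝔞 : Ideal R)
    (M : Type u) [AddCommGroup M] [Module R M] (i : ℕ) : ModuleCat.{u} R :=
  (localCohomology 𝔞 i).obj (ModuleCat.of R M)

/-- An `R`-module `M` is `𝔞`-cofinite if `Supp M ⊆ V(𝔞)` and all the modules
`Ext^i_R(R/𝔞, M)` are finitely generated. -/
def IsCofinite (R : Type u) [CommRing R] (𝔞 : Ideal R)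
    (M : Type u) [AddCommGroup M] [Module R M] : Prop :=
  Module.support R M ⊆ PrimeSpectrum.zeroLocus (𝔞 : Set R) ∧
    ∀ i : ℕ, Module.Finite R (extModule R (R ⧸ 𝔞) M i)

/-- An `R`-module `M` is `FD_{<n}` if it has a finitely generated submodule `N` such that
the (Krull) dimension of the support of `M/N` is `< n`. -/
def IsFDLT (R : Type u) [CommRing R] (n : ℕ)
    (M : Type u) [AddCommGroup M] [Module R M] : Prop :=
  ∃ N : Submodule R M, N.FG ∧
    Order.krullDim (Module.support R (M ⧸ N)) < ((n : ℕ∞) : WithBot ℕ∞)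

section Artinian
open Submodule

variable {A : Type*} [CommRing A]

lemma isArtinian_of_torsionBy {X : Type*} [AddCommGroup X] [Module A X] (x : A)
    (ht : ∀ m : X, ∃ k : ℕ, x ^ k • m = 0) [IsArtinian A (torsionBy A X x)] :
    IsArtinian A X := by
  let L (d : ℕ) (W : Submodule A X) : Submodule A (torsionBy A X x) :=
    ((W ⊓ torsionBy A X (x ^ (d + 1))).map (LinearMap.lsmul A X (x ^ d))).comap
      (torsionBy A X x).subtype
  have mem_L (d W) (z : torsionBy A X x) :
      z ∈ L d W ↔ ∃ w ∈ W, x ^ (d + 1) • w = 0 ∧ x ^ d • w = z := by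
    simp [L, and_assoc]
  have L_mono (d) {W W'} (h : W ≤ W') : L d W ≤ L d W' := by
    intro z
    simp only [mem_L]
    rintro ⟨w, hw, h1, h2⟩
    exact ⟨w, h hw, h1, h2⟩
  have L_succ (d W) : L (d + 1) W ≤ L d W := by
    intro z
    simp only [mem_L]
    rintro ⟨w, hw, h1, h2⟩
    exact ⟨x • w, W.smul_mem x hw, by rw [← mul_smul, ← pow_succ, h1],
      by rw [← mul_smul, ← pow_succ, h2]⟩
  have L_anti (W) : Antitone (L · W) := antitone_nat_of_succ_le (L_succ · W)
  have L_eq {W W' : Submodule A X} (h : W' ≤ W) (hL : ∀ d, L d W = L d W') : W = W' := by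
    refine le_antisymm (fun w hw => ?_) h
    obtain ⟨k, hk⟩ := ht w
    induction k generalizing w with
    | zero => simp_all
    | succ k ih =>
      obtain ⟨w', hw', h1, h2⟩ := (mem_L k W' ⟨x ^ k • w, by
        rw [mem_torsionBy_iff, ← mul_smul, ← pow_succ', hk]⟩).1
          (hL k ▸ (mem_L _ _ _).2 ⟨w, hw, hk, rfl⟩)
      have := ih (w - w') (W.sub_mem hw (h hw')) (by rw [smul_sub, h2]; simp)
      simpa using W'.add_mem this hw'
  rw [← monotone_stabilizes_iff_artinian]
  intro f
  have hf {m n : ℕ} (h : m ≤ n) : OrderDual.ofDual (f n) ≤ OrderDual.ofDual (f m) := f.monotone h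
  have stab (g : ℕ → Submodule A (torsionBy A X x)) (hg : Antitone g) :
      ∃ n, ∀ m, n ≤ m → g n = g m :=
    IsArtinian.monotone_stabilizes ⟨g, hg⟩
  obtain ⟨N, hN⟩ := stab (fun n => L n (OrderDual.ofDual (f n))) fun m n h =>
    (L_anti _ h).trans (L_mono _ (hf h))
  choose c hc using fun d => stab (fun n => L d (OrderDual.ofDual (f n))) fun m n h =>
    L_mono _ (hf h)
  refine ⟨N + ∑ d ∈ Finset.range N, c d, fun m hm => L_eq (hf hm) fun d => ?_⟩
  rcases lt_or_ge d N with hd | hd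
  · have := Finset.single_le_sum (f := c) (fun _ _ => Nat.zero_le _) (Finset.mem_range.2 hd)
    exact (hc d _ (by lia)).symm.trans (hc d _ (by lia))
  · have key (n) (hn : N ≤ n) : L d (OrderDual.ofDual (f n)) = L N (OrderDual.ofDual (f N)) := by
      refine le_antisymm ((L_anti _ hd).trans (L_mono _ (hf hn))) ?_
      rw [hN (max d n) (by lia)]
      exact (L_anti _ (le_max_left d n)).trans (L_mono _ (hf (le_max_right d n)))
    exact (key _ (Nat.le_add_right _ _)).trans (key m (le_trans (Nat.le_add_right _ _) hm)).symm

lemma isArtinian_of_torsionBySet_finset {X : Type*} [AddCommGroup X] [Module A X] (S : Finset A)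
    (ht : ∀ x ∈ S, ∀ m : X, ∃ k : ℕ, x ^ k • m = 0)
    (h : IsArtinian A (torsionBySet A X (S : Set A))) : IsArtinian A X := by
  classical
  induction S using Finset.induction_on with
  | empty =>
    have : torsionBySet A X ((∅ : Finset A) : Set A) = ⊤ := by
      ext; simp [mem_torsionBySet_iff]
    rw [this] at h
    exact isArtinian_of_linearEquiv (Submodule.topEquiv (R := A) (M := X))
  | insert x S hx ih =>
    refine ih (fun y hy => ht y (Finset.mem_insert_of_mem hy)) ?_
    let Z := torsionBySet A X (S : Set A)
    have : IsArtinian A (torsionBy A Z x) := by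
      let g : torsionBy A Z x →ₗ[A] torsionBySet A X ((insert x S : Finset A) : Set A) :=
        (Z.subtype ∘ₗ (torsionBy A Z x).subtype).codRestrict _ fun z => by
          rw [mem_torsionBySet_iff]
          rintro ⟨y, hy⟩
          rcases Finset.mem_insert.1 hy with rfl | hy
          · exact congrArg Subtype.val ((mem_torsionBy_iff _ _).1 z.2)
          · exact (mem_torsionBySet_iff _ _).1 z.1.2 ⟨y, hy⟩
      refine isArtinian_of_injective g fun a b hab => ?_
      have := congrArg Subtype.val hab
      exact Subtype.ext (Subtype.ext this)
    refine isArtinian_of_torsionBy x fun m => ?_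
    obtain ⟨k, hk⟩ := ht x (Finset.mem_insert_self _ _) m
    exact ⟨k, Subtype.ext hk⟩

/-- A torsion module with respect to a finitely generated ideal is Artinian
as soon as the submodule killed by the ideal is. -/
lemma isArtinian_of_torsionBySet {X : Type*} [AddCommGroup X] [Module A X] {I : Ideal A}
    (hI : I.FG) (ht : ∀ x ∈ I, ∀ m : X, ∃ k : ℕ, x ^ k • m = 0)
    (h : IsArtinian A (torsionBySet A X (I : Set A))) : IsArtinian A X := by
  obtain ⟨S, rfl⟩ := hI
  refine isArtinian_of_torsionBySet_finset S (fun x hx => ht x (Ideal.subset_span hx)) ?_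
  rwa [torsionBySet_eq_torsionBySet_span]

lemma isArtinian_of_support_isMaximal [IsNoetherianRing A] {X : Type*} [AddCommGroup X] [Module A X]
    [Module.Finite A X] (h : ∀ p ∈ Module.support A X, p.asIdeal.IsMaximal) : IsArtinian A X := by
  induction ‹Module.Finite A X› using
    IsNoetherianRing.induction_on_isQuotientEquivQuotientPrime A with
  | subsingleton N => infer_instance
  | quotient N p f =>
    have hp : p.asIdeal.IsMaximal := by
      refine h p ?_
      rw [f.support_eq]
      simp [Module.mem_support_iff_of_finite, Ideal.annihilator_quotient]
    have : IsArtinian A (A ⧸ p.asIdeal) := by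
      let _ := Ideal.Quotient.field p.asIdeal
      have : IsArtinianRing (A ⧸ p.asIdeal) := inferInstance
      exact isArtinian_of_surjective_algebraMap (S := A) (R := A ⧸ p.asIdeal) (M := A ⧸ p.asIdeal)
        Ideal.Quotient.mk_surjective
    exact isArtinian_of_linearEquiv f.symm
  | exact N₁ N₂ N₃ f g hf hg hfg h₁ h₃ =>
    have := h₁ fun p hp => h p (Module.support_subset_of_injective f hf hp)
    have := h₃ fun p hp => h p (Module.support_subset_of_surjective g hg hp)
    exact isArtinian_of_range_eq_ker f g (hfg.linearMap_ker_eq).symm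

end Artinian

section SupIrred
open Submodule

variable {A : Type*} [CommRing A] {Y : Type*} [AddCommGroup Y] [Module A Y] [IsArtinian A Y]

lemma SupIrred.map_lsmul_eq_or_mem_radical {W : Submodule A Y} (hW : SupIrred W) (r : A) :
    W.map (LinearMap.lsmul A Y r) = W ∨ r ∈ W.annihilator.radical := by
  let f : W →ₗ[A] W := LinearMap.lsmul A W r
  have hf (k : ℕ) (w : W) : (f ^ k) w = r ^ k • w := by
    induction k with
    | zero => simp
    | succ k ih => rw [pow_succ', Module.End.mul_apply, ih, pow_succ', mul_smul]; rfl
  obtain ⟨k, hk⟩ := f.eventually_codisjoint_ker_pow_range_pow.exists_forall_of_atTop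
  specialize hk (k + 1) (Nat.le_succ k)
  have hsup : (LinearMap.ker (f ^ (k + 1))).map W.subtype ⊔
      (LinearMap.range (f ^ (k + 1))).map W.subtype = W := by
    rw [← Submodule.map_sup, hk.eq_top, Submodule.map_top, Submodule.range_subtype]
  rcases hW.2 hsup with h | h
  · refine Or.inr ⟨k + 1, Submodule.mem_annihilator.2 fun w hw => ?_⟩
    rw [← h] at hw
    obtain ⟨w, hw, rfl⟩ := hw
    rw [SetLike.mem_coe, LinearMap.mem_ker, hf] at hw
    exact congrArg Subtype.val hw
  · refine Or.inl (le_antisymm ?_ fun w hw => ?_)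
    · rintro _ ⟨w, hw, rfl⟩
      exact W.smul_mem _ hw
    · rw [← h] at hw
      obtain ⟨_, ⟨w, rfl⟩, rfl⟩ := hw
      refine ⟨r ^ k • (w : Y), W.smul_mem _ w.2, ?_⟩
      rw [hf, pow_succ', mul_smul]
      rfl

lemma SupIrred.isPrime_radical_annihilator {W : Submodule A Y} (hW : SupIrred W) :
    W.annihilator.radical.IsPrime := by
  refine ⟨?_, fun {r s} hrs => ?_⟩
  · rw [Ne, Ideal.radical_eq_top, Submodule.annihilator_eq_top_iff]
    exact hW.ne_bot
  · rcases hW.map_lsmul_eq_or_mem_radical r with h | h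
    · right
      obtain ⟨k, hk⟩ := hrs
      refine ⟨k, Submodule.mem_annihilator.2 fun w hw => ?_⟩
      have hsurj : ∀ n : ℕ, ∀ w ∈ W, ∃ v ∈ W, r ^ n • v = w := by
        intro n
        induction n with
        | zero => exact fun w hw => ⟨w, hw, by simp⟩
        | succ n ih =>
          intro w hw
          obtain ⟨v, hv, rfl⟩ := ih w hw
          rw [← h] at hv
          obtain ⟨v, hv, rfl⟩ := hv
          exact ⟨v, hv, by rw [pow_succ, mul_smul]; rfl⟩
      obtain ⟨v, hv, rfl⟩ := hsurj k w hw
      rw [← mul_smul, ← mul_pow, mul_comm]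
      exact Submodule.mem_annihilator.1 hk v hv
    · exact Or.inl h

/-- If every submodule of an Artinian module killed by a power of an ideal is finitely generated,
then some element of the ideal acts surjectively up to a finitely generated submodule. -/
lemma exists_sup_range_lsmul_eq_top {R : Type*} [CommRing R] [Algebra R A] {I : Ideal R}
    (hI : I.FG) (h : ∀ (W : Submodule A Y) (k : ℕ),
      I.map (algebraMap R A) ^ k ≤ W.annihilator → W.FG) :
    ∃ x ∈ I, ∃ F : Submodule A Y,
      F.FG ∧ F ⊔ LinearMap.range (LinearMap.lsmul A Y (algebraMap R A x)) = ⊤ := by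
  classical
  obtain ⟨s, hs, hirr⟩ := exists_supIrred_decomposition (⊤ : Submodule A Y)
  let P (W : Submodule A Y) : Ideal R := W.annihilator.radical.comap (algebraMap R A)
  let t := s.filter fun W => ¬ I ≤ P W
  have hx : ∃ x ∈ I, ∀ W ∈ t, x ∉ P W := by
    by_contra! hcon
    have : ((I : Ideal R) : Set R) ⊆ ⋃ W ∈ (t : Set (Submodule A Y)), P W := by
      intro x hx
      obtain ⟨W, hW, hxW⟩ := hcon x hx
      exact Set.mem_biUnion hW hxW
    rw [Ideal.subset_union_prime (⊥ : Submodule A Y) ⊥] at this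
    · obtain ⟨W, hW, hle⟩ := this
      exact (Finset.mem_filter.1 hW).2 hle
    · intro W hW _ _
      have := (hirr (Finset.mem_filter.1 hW).1).isPrime_radical_annihilator
      exact Ideal.comap_isPrime _ _
  obtain ⟨x, hxI, hx⟩ := hx
  refine ⟨x, hxI, (s.filter fun W => I ≤ P W).sup id, ?_, ?_⟩
  · refine Submodule.fg_finset_sup _ _ fun W hW => ?_
    have hle := (Finset.mem_filter.1 hW).2
    obtain ⟨k, hk⟩ := Ideal.exists_pow_le_of_le_radical_of_fg
      (Ideal.map_le_iff_le_comap.2 hle) (hI.map _)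
    exact h W k hk
  · rw [eq_top_iff, ← hs]
    refine Finset.sup_le fun W hW => ?_
    by_cases hIW : I ≤ P W
    · exact le_sup_of_le_left (Finset.le_sup (f := id) (Finset.mem_filter.2 ⟨hW, hIW⟩))
    · refine le_sup_of_le_right ?_
      rcases (hirr hW).map_lsmul_eq_or_mem_radical (algebraMap R A x) with h | h
      · rw [id, ← h]
        exact LinearMap.map_le_range
      · exact absurd h (hx W (Finset.mem_filter.2 ⟨hW, hIW⟩))

/-- If the submodule killed by an ideal is Noetherian, so is any submodule killed by a power. -/
lemma fg_of_pow_le_annihilator {A : Type*} [CommRing A] [IsNoetherianRing A] {Y : Type*}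
    [AddCommGroup Y] [Module A Y] {I : Ideal A}
    (h : IsNoetherian A (torsionBySet A Y (I : Set A))) {k : ℕ} (W : Submodule A Y)
    (hW : I ^ k ≤ W.annihilator) : W.FG := by
  obtain ⟨S, hS⟩ := (isNoetherianRing_iff_ideal_fg A).1 ‹_› I
  induction k generalizing W with
  | zero =>
    rw [pow_zero, Ideal.one_eq_top, top_le_iff, Submodule.annihilator_eq_top_iff] at hW
    exact hW ▸ Submodule.fg_bot
  | succ k ih =>
    let V : Submodule A Y := I • W
    have hV : V.FG := by
      refine ih V ?_
      rw [Submodule.le_annihilator_iff]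
      rw [Submodule.le_annihilator_iff, pow_succ, mul_smul] at hW
      exact hW
    have hVn : IsNoetherian A V := isNoetherian_of_fg_of_noetherian V hV
    let g : W →ₗ[A] (S → V) := LinearMap.pi fun x =>
      (LinearMap.lsmul A Y x ∘ₗ W.subtype).codRestrict V fun w =>
        Submodule.smul_mem_smul (hS ▸ Ideal.subset_span x.2) w.2
    have hker : IsNoetherian A (LinearMap.ker g) := by
      let e : LinearMap.ker g →ₗ[A] torsionBySet A Y (I : Set A) :=
        (W.subtype ∘ₗ (LinearMap.ker g).subtype).codRestrict _ fun w => by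
          rw [← hS, ← torsionBySet_eq_torsionBySet_span, mem_torsionBySet_iff]
          exact fun x => congrArg Subtype.val (congrFun (LinearMap.mem_ker.1 w.2) x)
      refine isNoetherian_of_injective e fun a b hab => ?_
      have := congrArg Subtype.val hab
      exact Subtype.ext (Subtype.ext this)
    have : IsNoetherian A W := by
      refine isNoetherian_of_range_eq_ker (LinearMap.ker g).subtype g ?_
      exact Submodule.range_subtype _
    exact (isNoetherian_submodule.1 this) W le_rfl

end SupIrred

namespace CategoryTheory.ProjectiveResolution
open Abelian

section
variable {C : Type*} [Category C] [Abelian C] [HasExt C] {X Y : C} (P : ProjectiveResolution X)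
open CochainComplex HomComplex

lemma extMk_zero_eq_zero_iff (f : P.complex.X 0 ⟶ Y) (hf : P.complex.d 1 0 ≫ f = 0) :
    P.extMk f 1 rfl hf = 0 ↔ f = 0 := by
  refine ⟨fun h => ?_, fun h => by subst h; simp⟩
  simp only [← P.extEquivCohomologyClass.apply_eq_iff_eq,
    extEquivCohomologyClass_extMk, extEquivCohomologyClass_zero,
    CohomologyClass.mk_eq_zero_iff] at h
  rw [Cocycle.toSingleMk_mem_coboundaries_iff _ _ _ _ _ 1 (by lia)] at h
  obtain ⟨g, hg⟩ := h
  have : P.cochainComplex.d (-(0:ℕ)) 1 = 0 :=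
    (CochainComplex.isZero_of_isStrictlyLE P.cochainComplex 0 1).eq_of_tgt _ _
  rw [this, Limits.zero_comp] at hg
  rw [← cancel_epi (P.cochainComplexXIso (-(0:ℕ)) 0 rfl).hom, ← hg, Limits.comp_zero]
end

section
variable {R : Type u} [CommRing R] {X : ModuleCat.{u} R} (P : ProjectiveResolution X)
  (Y : ModuleCat.{u} R) (n : ℕ)

/-- The complex of morphisms from a projective resolution into a module. -/
noncomputable abbrev homComplex := P.complex.linearYonedaObj R Y

variable {Y n} in
lemma d_comp_iCycles (z : (P.homComplex Y).cycles n) :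
    P.complex.d (n + 1) n ≫ (show P.complex.X n ⟶ Y from (P.homComplex Y).iCycles n z) = 0 := by
  have := congr($((P.homComplex Y).iCycles_d n (n + 1)) z)
  exact this

/-- The class in `Ext` of a cocycle. -/
noncomputable def cyclesToExt : (P.homComplex Y).cycles n →ₗ[R] Ext X Y n where
  toFun z := P.extMk (show P.complex.X n ⟶ Y from (P.homComplex Y).iCycles n z) (n + 1) rfl
    (P.d_comp_iCycles z)
  map_add' z w := by
    rw [add_extMk]
    congr 1
    exact map_add ((P.homComplex Y).iCycles n).hom z w
  map_smul' r z := by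
    rw [RingHom.id_apply, Ext.smul_eq_comp_mk₀, extMk_comp_mk₀]
    congr 1
    refine (map_smul ((P.homComplex Y).iCycles n).hom r z).trans ?_
    erw [Linear.comp_smul]
    erw [Category.comp_id]
    rfl

lemma exists_iCycles_eq (f : P.complex.X n ⟶ Y) (hf : P.complex.d (n + 1) n ≫ f = 0) :
    ∃ z, (P.homComplex Y).iCycles n z = f := by
  let φ : ModuleCat.of R R ⟶ (P.homComplex Y).X n :=
    ModuleCat.ofHom (LinearMap.toSpanSingleton R (P.complex.X n ⟶ Y) f)
  have hφ : φ ≫ (P.homComplex Y).d n (n + 1) = 0 := by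
    ext
    change P.complex.d (n + 1) n ≫ ((1 : R) • f) = 0
    rw [one_smul, hf]
  refine ⟨(P.homComplex Y).liftCycles φ (n + 1) (by simp) hφ (1 : R), ?_⟩
  have := congr($((P.homComplex Y).liftCycles_i φ (n + 1) (by simp) hφ) (1 : R))
  exact this.trans (one_smul R f)

lemma cyclesToExt_surjective : Function.Surjective (P.cyclesToExt Y n) := by
  intro α
  obtain ⟨f, hf, rfl⟩ := P.extMk_surjective α (n + 1) rfl
  obtain ⟨z, rfl⟩ := P.exists_iCycles_eq Y n f hf
  exact ⟨z, rfl⟩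

lemma homologyπ_eq_zero_iff (p : ℕ) (hp : (ComplexShape.up ℕ).prev n = p)
    (z : (P.homComplex Y).cycles n) : (P.homComplex Y).homologyπ n z = 0 ↔
      ∃ w : P.complex.X p ⟶ Y, P.complex.d n p ≫ w = (P.homComplex Y).iCycles n z := by
  have hex : (ShortComplex.mk _ _ ((P.homComplex Y).toCycles_comp_homologyπ p n)).Exact :=
    ShortComplex.exact_of_g_is_cokernel _ ((P.homComplex Y).homologyIsCokernel p n hp)
  constructor
  · intro h
    obtain ⟨w, hw⟩ := (ShortComplex.moduleCat_exact_iff _).1 hex z h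
    refine ⟨w, ?_⟩
    have := congr($((P.homComplex Y).toCycles_i p n) w)
    rw [← hw]
    exact this.symm
  · rintro ⟨w, hw⟩
    have hz : (P.homComplex Y).toCycles p n w = z := by
      apply (ModuleCat.mono_iff_injective ((P.homComplex Y).iCycles n)).1 inferInstance
      have := congr($((P.homComplex Y).toCycles_i p n) w)
      exact this.trans hw
    rw [← hz]
    exact congr($((P.homComplex Y).toCycles_comp_homologyπ p n) w)

lemma cyclesToExt_eq_zero_iff (z : (P.homComplex Y).cycles n) :
    P.cyclesToExt Y n z = 0 ↔ (P.homComplex Y).homologyπ n z = 0 := by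
  cases n with
  | zero =>
    rw [homologyπ_eq_zero_iff P Y 0 0 (by simp)]
    refine (P.extMk_zero_eq_zero_iff _ (P.d_comp_iCycles z)).trans ?_
    simp only [HomologicalComplex.shape, ComplexShape.down_Rel, zero_add, one_ne_zero, not_false_eq_true,
      Limits.zero_comp, exists_const]
    exact eq_comm
  | succ p =>
    rw [homologyπ_eq_zero_iff P Y (p + 1) p (by simp)]
    exact P.extMk_eq_zero_iff _ _ rfl (P.d_comp_iCycles z) p rfl

lemma exists_linearEquiv_ext :
    ∃ e : (P.homComplex Y).homology n ≃ₗ[R] Ext X Y n,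
      ∀ z, e ((P.homComplex Y).homologyπ n z) = P.cyclesToExt Y n z := by
  have hs : Function.Surjective ((P.homComplex Y).homologyπ n).hom :=
    (ModuleCat.epi_iff_surjective _).1 inferInstance
  have hk : LinearMap.ker ((P.homComplex Y).homologyπ n).hom =
      LinearMap.ker (P.cyclesToExt Y n) := by
    ext z
    exact (P.cyclesToExt_eq_zero_iff Y n z).symm
  refine ⟨(LinearMap.quotKerEquivOfSurjective _ hs).symm ≪≫ₗ Submodule.quotEquivOfEq _ _ hk ≪≫ₗ
    LinearMap.quotKerEquivOfSurjective _ (P.cyclesToExt_surjective Y n), fun z => ?_⟩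
  have : (LinearMap.quotKerEquivOfSurjective _ hs).symm ((P.homComplex Y).homologyπ n z) =
    Submodule.Quotient.mk z := by
    rw [LinearEquiv.symm_apply_eq]; rfl
  simp only [LinearEquiv.trans_apply]
  erw [this]
  rfl

/-- The comparison between the derived functor of `Hom` and `Abelian.Ext`. -/
noncomputable def extEquiv :
    ((Ext R (ModuleCat.{u} R) n).obj (Opposite.op X)).obj Y ≃ₗ[R] Abelian.Ext X Y n :=
  (P.isoExt n Y).toLinearEquiv ≪≫ₗ (P.exists_linearEquiv_ext Y n).choose

lemma exists_extEquiv_symm_eq (x : ((Ext R (ModuleCat.{u} R) n).obj (Opposite.op X)).obj Y) :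
    ∃ z, (P.isoExt n Y).hom x = (P.homComplex Y).homologyπ n z ∧
      P.extEquiv Y n x = P.cyclesToExt Y n z := by
  obtain ⟨z, hz⟩ := (ModuleCat.epi_iff_surjective ((P.homComplex Y).homologyπ n)).1 inferInstance
    ((P.isoExt n Y).hom x)
  refine ⟨z, hz.symm, ?_⟩
  rw [← (P.exists_linearEquiv_ext Y n).choose_spec z, hz]
  rfl

end

section
variable {R : Type u} [CommRing R] {X X' : ModuleCat.{u} R} {P : ProjectiveResolution X}
  {P' : ProjectiveResolution X'} {f : X ⟶ X'} (φ : Hom P P' f) (Y : ModuleCat.{u} R) (n : ℕ)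

/-- Precomposition with a morphism of resolutions, on the complexes of morphisms. -/
noncomputable def homComplexMap : P'.homComplex Y ⟶ P.homComplex Y :=
  (HomologicalComplex.unopFunctor _ _).map
    (((((linearYoneda R _).obj Y).rightOp.mapHomologicalComplex _).map φ.hom)).op

lemma isoExt_naturality :
    ((Ext R (ModuleCat.{u} R) n).map f.op).app Y ≫ (P.isoExt n Y).hom =
      (P'.isoExt n Y).hom ≫ HomologicalComplex.homologyMap (homComplexMap φ Y) n := by
  have key {C : Type (u + 1)} [Category.{u} C] {E E' H H' K K' : C} (A : E' ⟶ E) (a : E ⟶ H)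
      (a' : E' ⟶ H') (b : H' ⟶ H) (p : K ≅ H) (p' : K' ≅ H') (m : K' ⟶ K)
      (h1 : A ≫ a = a' ≫ b) (h2 : p'.hom ≫ b = m ≫ p.hom) :
      A ≫ a ≫ p.inv = (a' ≫ p'.inv) ≫ m := by
    rw [reassoc_of% h1, Category.assoc, ← p'.inv_hom_id_assoc (b ≫ p.inv), reassoc_of% h2]
    simp
  have h1 := isoLeftDerivedObj_inv_naturality f P P' φ.hom φ.hom_f_zero_comp_π_f_zero
    ((linearYoneda R _).obj Y).rightOp n
  have h2 := HomologicalComplex.homologyOp_hom_naturality (homComplexMap φ Y) n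
  replace h1 := congr($(h1).unop)
  replace h2 := congr($(h2).unop)
  exact key _ _ _ _ _ _ _ h1 h2

lemma extEquiv_naturality (φ : Hom P P' f)
    (x : ((Ext R (ModuleCat.{u} R) n).obj (Opposite.op X')).obj Y) :
    P.extEquiv Y n (((Ext R (ModuleCat.{u} R) n).map f.op).app Y x) =
      (Ext.mk₀ f).comp (P'.extEquiv Y n x) (zero_add n) := by
  obtain ⟨z, hz, hz'⟩ := P'.exists_extEquiv_symm_eq Y n x
  have h1 := congr($(isoExt_naturality φ Y n) x)
  have h2 := congr($(HomologicalComplex.homologyπ_naturality (homComplexMap φ Y) n) z)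
  have h3 : (P.isoExt n Y).hom (((Ext R (ModuleCat.{u} R) n).map f.op).app Y x) =
      (P.homComplex Y).homologyπ n (HomologicalComplex.cyclesMap (homComplexMap φ Y) n z) := by
    refine h1.trans (Eq.trans ?_ h2)
    exact congrArg (HomologicalComplex.homologyMap (homComplexMap φ Y) n) hz
  have h4 : P.extEquiv Y n (((Ext R (ModuleCat.{u} R) n).map f.op).app Y x) =
      P.cyclesToExt Y n (HomologicalComplex.cyclesMap (homComplexMap φ Y) n z) := by
    rw [← (P.exists_linearEquiv_ext Y n).choose_spec, ← h3]
    rfl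
  rw [h4, hz']
  refine Eq.trans ?_ (mk₀_comp_extMk _ _ rfl (P'.d_comp_iCycles z) φ).symm
  simp only [cyclesToExt, LinearMap.coe_mk, AddHom.coe_mk]
  congr 1
  exact congr($(HomologicalComplex.cyclesMap_i (homComplexMap φ Y) n) z)

end

section
variable {R : Type u} [CommRing R] {X X' : ModuleCat.{u} R} (f : X ⟶ X')

lemma nonempty_hom (P : ProjectiveResolution X) (P' : ProjectiveResolution X') :
    Nonempty (Hom P P' f) := by
  refine ⟨⟨lift f P P', ?_⟩⟩
  exact congr($(lift_commutes f P P').f 0)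

end
end CategoryTheory.ProjectiveResolution

section
variable {R : Type u} [CommRing R] (𝔞 : Ideal R)

/-- The projection `R ⧸ 𝔞 ^ n ⟶ R ⧸ 𝔞 ^ m` for `m ≤ n`. -/
noncomputable def quotientPowHom {m n : ℕ} (h : m ≤ n) :
    ModuleCat.of R (R ⧸ 𝔞 ^ n) ⟶ ModuleCat.of R (R ⧸ 𝔞 ^ m) :=
  ModuleCat.ofHom (Submodule.mapQ _ _ LinearMap.id (Ideal.pow_le_pow_right h))

/-- The transition map `Ext^i(R ⧸ 𝔞 ^ m, Y) → Ext^i(R ⧸ 𝔞 ^ n, Y)` for `m ≤ n`. -/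
noncomputable abbrev extPowMap (Y : ModuleCat.{u} R) (i : ℕ) (m n : ℕ) (h : m ≤ n) :
    Abelian.Ext (ModuleCat.of R (R ⧸ 𝔞 ^ m)) Y i →ₗ[R]
      Abelian.Ext (ModuleCat.of R (R ⧸ 𝔞 ^ n)) Y i :=
  (Abelian.Ext.mk₀ (quotientPowHom 𝔞 h)).precompOfLinear R Y (zero_add i)

lemma extPowMap_apply (Y : ModuleCat.{u} R) (i : ℕ) (m n : ℕ) (h : m ≤ n)
    (α : Abelian.Ext (ModuleCat.of R (R ⧸ 𝔞 ^ m)) Y i) :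
    extPowMap 𝔞 Y i m n h α = (Abelian.Ext.mk₀ (quotientPowHom 𝔞 h)).comp α (zero_add i) := rfl

lemma quotientPowHom_self (n : ℕ) : quotientPowHom 𝔞 (le_refl n) = 𝟙 _ := by
  ext
  rfl

lemma quotientPowHom_comp {l m n : ℕ} (h : l ≤ m) (h' : m ≤ n) :
    quotientPowHom 𝔞 h' ≫ quotientPowHom 𝔞 h = quotientPowHom 𝔞 (h.trans h') := by
  ext
  rfl

instance directedSystem_extPowMap (Y : ModuleCat.{u} R) (i : ℕ) :
    DirectedSystem (fun n => Abelian.Ext (ModuleCat.of R (R ⧸ 𝔞 ^ n)) Y i)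
      (fun m n h => extPowMap 𝔞 Y i m n h) where
  map_self n x := by
    rw [extPowMap_apply, quotientPowHom_self, Abelian.Ext.mk₀_id_comp]
  map_map l m n h h' x := by
    simp only [extPowMap_apply, Abelian.Ext.mk₀_comp_mk₀_assoc, quotientPowHom_comp]

/-- Local cohomology as a sequential direct limit of `Ext` modules. -/
abbrev ExtLimit (Y : ModuleCat.{u} R) (i : ℕ) : Type u :=
  Module.DirectLimit (fun n => Abelian.Ext (ModuleCat.of R (R ⧸ 𝔞 ^ n)) Y i)
    (fun m n h => extPowMap 𝔞 Y i m n h)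

open Opposite

/-- The diagram of `Ext` modules whose colimit is the `i`-th local cohomology of `Y`. -/
noncomputable abbrev localCohomologyDiagram (Y : ModuleCat.{u} R) (i : ℕ) :
    ℕᵒᵖᵒᵖ ⥤ ModuleCat.{u} R :=
  localCohomology.diagram (localCohomology.idealPowersDiagram 𝔞) i ⋙ (evaluation _ _).obj Y

lemma nonempty_linearEquiv_extLimit (Y : ModuleCat.{u} R) (i : ℕ) :
    Nonempty ((localCohomology 𝔞 i).obj Y ≃ₗ[R] ExtLimit 𝔞 Y i) := by
  let F := localCohomologyDiagram 𝔞 Y i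
  have hfil : IsFiltered ℕᵒᵖᵒᵖ := IsFiltered.of_equivalence (opOpEquivalence ℕ).symm
  have hpres : Limits.PreservesColimit F (forget (ModuleCat.{u} R)) := by
    have : Limits.PreservesFilteredColimits (forget (ModuleCat.{u} R)) := inferInstance
    have : Limits.PreservesFilteredColimitsOfSize.{0, 0} (forget (ModuleCat.{u} R)) :=
      Limits.preservesFilteredColimitsOfSize_shrink.{0, u, 0, u} _
    have := this.preserves_filtered_colimits ℕᵒᵖᵒᵖ
    infer_instance
  have hD := Limits.isColimitOfPreserves ((evaluation _ _).obj Y)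
    (Limits.colimit.isColimit (localCohomology.diagram (localCohomology.idealPowersDiagram 𝔞) i))
  set D := ((evaluation _ _).obj Y).mapCocone (Limits.colimit.cocone
    (localCohomology.diagram (localCohomology.idealPowersDiagram 𝔞) i)) with hDdef
  let e (n : ℕ) : F.obj (op (op n)) ≃ₗ[R] Abelian.Ext (ModuleCat.of R (R ⧸ 𝔞 ^ n)) Y i :=
    (projectiveResolution (ModuleCat.of R (R ⧸ 𝔞 ^ n))).extEquiv Y i
  let g (n : ℕ) : Abelian.Ext (ModuleCat.of R (R ⧸ 𝔞 ^ n)) Y i →ₗ[R] D.pt :=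
    (D.ι.app (op (op n))).hom ∘ₗ (e n).symm.toLinearMap
  have he (m n : ℕ) (h : m ≤ n) (x) : e n (F.map (homOfLE h).op.op x) =
      extPowMap 𝔞 Y i m n h (e m x) := by
    obtain ⟨φ⟩ := ProjectiveResolution.nonempty_hom (quotientPowHom 𝔞 h)
      (projectiveResolution (ModuleCat.of R (R ⧸ 𝔞 ^ n)))
      (projectiveResolution (ModuleCat.of R (R ⧸ 𝔞 ^ m)))
    exact ProjectiveResolution.extEquiv_naturality Y i φ x
  have hg (m n : ℕ) (h : m ≤ n) (x) : g n (extPowMap 𝔞 Y i m n h x) = g m x := by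
    obtain ⟨x, rfl⟩ := (e m).surjective x
    rw [← he]
    simp only [g, LinearMap.comp_apply, LinearEquiv.coe_coe, LinearEquiv.symm_apply_apply]
    exact congr($(D.w (homOfLE h).op.op) x)
  refine ⟨(LinearEquiv.ofBijective (Module.DirectLimit.lift R ℕ _ _ g hg) ⟨?_, ?_⟩).symm⟩
  · rw [injective_iff_map_eq_zero]
    intro z hz
    obtain ⟨n, x, rfl⟩ := Module.DirectLimit.exists_of z
    obtain ⟨x, rfl⟩ := (e n).surjective x
    rw [Module.DirectLimit.lift_of] at hz
    simp only [g, LinearMap.comp_apply, LinearEquiv.coe_coe, LinearEquiv.symm_apply_apply] at hz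
    obtain ⟨k, a, b, hab⟩ := Limits.Concrete.isColimit_exists_of_rep_eq F hD x
      (0 : F.obj (op (op n))) (by rw [map_zero]; exact hz)
    have hk : n ≤ k.unop.unop := leOfHom a.unop.unop
    rw [← Module.DirectLimit.of_f (hij := hk), ← he]
    have : F.map (homOfLE hk).op.op x = 0 := by
      rw [map_zero] at hab
      exact hab
    erw [this]
    simp
  · intro z
    obtain ⟨j, y, hy⟩ := Limits.Concrete.isColimit_exists_rep F hD z
    refine ⟨Module.DirectLimit.of R ℕ _ _ j.unop.unop (e _ y), ?_⟩
    rw [Module.DirectLimit.lift_of]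
    simp only [g, LinearMap.comp_apply, LinearEquiv.coe_coe, LinearEquiv.symm_apply_apply]
    exact hy
end

section ExtMap
variable {R : Type u} [CommRing R] (N : ModuleCat.{u} R)
  {X Y Z : Type u} [AddCommGroup X] [Module R X] [AddCommGroup Y] [Module R Y]
  [AddCommGroup Z] [Module R Z]

/-- The map induced on `Ext^i(N, -)` by a linear map. -/
noncomputable def extMap (i : ℕ) (f : X →ₗ[R] Y) :
    Abelian.Ext N (ModuleCat.of R X) i →ₗ[R] Abelian.Ext N (ModuleCat.of R Y) i :=
  (Abelian.Ext.mk₀ (ModuleCat.ofHom f)).postcompOfLinear R N (add_zero i)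

lemma extMap_apply (i : ℕ) (f : X →ₗ[R] Y) (α : Abelian.Ext N (ModuleCat.of R X) i) :
    extMap N i f α = α.comp (Abelian.Ext.mk₀ (ModuleCat.ofHom f)) (add_zero i) := rfl

lemma extMap_comp (i : ℕ) (g : Y →ₗ[R] Z) (f : X →ₗ[R] Y) :
    extMap N i (g ∘ₗ f) = extMap N i g ∘ₗ extMap N i f := by
  ext α
  simp [extMap_apply, ModuleCat.ofHom_comp]

lemma extMap_id (i : ℕ) : extMap N i (LinearMap.id : X →ₗ[R] X) = LinearMap.id := by
  ext α
  simp [extMap_apply]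

lemma extMap_lsmul (i : ℕ) (r : R) : extMap N i (LinearMap.lsmul R X r) = r • LinearMap.id := by
  ext α
  have : ModuleCat.ofHom (LinearMap.lsmul R X r) = r • 𝟙 (ModuleCat.of R X) := rfl
  rw [extMap_apply, this, Abelian.Ext.mk₀_smul]
  simp

/-- The isomorphism induced on `Ext^i(N, -)` by a linear equivalence. -/
noncomputable def extCongr (i : ℕ) (e : X ≃ₗ[R] Y) :
    Abelian.Ext N (ModuleCat.of R X) i ≃ₗ[R] Abelian.Ext N (ModuleCat.of R Y) i :=
  LinearEquiv.ofLinearMap (extMap N i e.toLinearMap) (extMap N i e.symm.toLinearMap)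
    (by rw [← extMap_comp]; simp [extMap_id]) (by rw [← extMap_comp]; simp [extMap_id])

lemma smul_ext_eq_zero {N : ModuleCat.{u} R} {r : R} (hr : r • 𝟙 N = 0) {Y : ModuleCat.{u} R}
    {i : ℕ} (α : Abelian.Ext N Y i) : r • α = 0 := by
  rw [← Abelian.Ext.mk₀_id_comp α, ← Abelian.Ext.smul_comp, ← Abelian.Ext.mk₀_smul, hr]
  simp

lemma smul_id_quotient_eq_zero {I : Ideal R} {r : R} (hr : r ∈ I) :
    r • 𝟙 (ModuleCat.of R (R ⧸ I)) = 0 := by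
  ext
  change r • (1 : R ⧸ I) = 0
  rw [Algebra.smul_def, mul_one]
  exact Ideal.Quotient.eq_zero_iff_mem.2 hr

variable {f : X →ₗ[R] Y} {g : Y →ₗ[R] Z}

lemma shortExact_ofHom (hf : Function.Injective f) (hfg : Function.Exact f g)
    (hg : Function.Surjective g) :
    (ShortComplex.mk (ModuleCat.ofHom f) (ModuleCat.ofHom g) (by
      ext x; exact hfg.apply_apply_eq_zero x)).ShortExact :=
  ModuleCat.shortComplex_shortExact _ hfg hf hg

/-- The connecting map of the long exact sequence of `Ext(N, -)`. -/
noncomputable def extδ (hf : Function.Injective f) (hfg : Function.Exact f g)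
    (hg : Function.Surjective g) (i : ℕ) :
    Abelian.Ext N (ModuleCat.of R Z) i →ₗ[R] Abelian.Ext N (ModuleCat.of R X) (i + 1) :=
  (shortExact_ofHom hf hfg hg).extClass.postcompOfLinear R N rfl

lemma extδ_apply (hf : Function.Injective f) (hfg : Function.Exact f g)
    (hg : Function.Surjective g) (i : ℕ) (α : Abelian.Ext N (ModuleCat.of R Z) i) :
    extδ N hf hfg hg i α = α.comp (shortExact_ofHom hf hfg hg).extClass rfl := rfl

lemma exact_extMap_extMap (hf : Function.Injective f) (hfg : Function.Exact f g)
    (hg : Function.Surjective g) (i : ℕ) : Function.Exact (extMap N i f) (extMap N i g) := by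
  intro α
  constructor
  · intro h
    exact Abelian.Ext.covariant_sequence_exact₂ N (shortExact_ofHom hf hfg hg) α h
  · rintro ⟨β, rfl⟩
    rw [← LinearMap.comp_apply, ← extMap_comp, hfg.linearMap_comp_eq_zero]
    simp [extMap_apply]

lemma exact_extMap_extδ (hf : Function.Injective f) (hfg : Function.Exact f g)
    (hg : Function.Surjective g) (i : ℕ) : Function.Exact (extMap N i g) (extδ N hf hfg hg i) := by
  intro α
  constructor
  · intro h
    exact Abelian.Ext.covariant_sequence_exact₃ N (shortExact_ofHom hf hfg hg) α rfl h
  · rintro ⟨β, rfl⟩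
    have := (shortExact_ofHom hf hfg hg).comp_extClass
    dsimp at this
    rw [extδ_apply, extMap_apply, Abelian.Ext.comp_assoc_of_second_deg_zero, this,
      Abelian.Ext.comp_zero]

lemma exact_extδ_extMap (hf : Function.Injective f) (hfg : Function.Exact f g)
    (hg : Function.Surjective g) (i : ℕ) :
    Function.Exact (extδ N hf hfg hg i) (extMap N (i + 1) f) := by
  intro α
  constructor
  · intro h
    exact Abelian.Ext.covariant_sequence_exact₁ N (shortExact_ofHom hf hfg hg) α h rfl
  · rintro ⟨β, rfl⟩
    have := (shortExact_ofHom hf hfg hg).extClass_comp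
    dsimp at this
    rw [extδ_apply, extMap_apply, Abelian.Ext.comp_assoc_of_third_deg_zero, this,
      Abelian.Ext.comp_zero]

lemma extMap_zero_injective (hf : Function.Injective f) : Function.Injective (extMap N 0 f) := by
  have : Mono (ModuleCat.ofHom f) := (ModuleCat.mono_iff_injective _).2 hf
  exact Abelian.Ext.postcomp_mk₀_injective_of_mono N (ModuleCat.ofHom f)

end ExtMap

section ExtFinite
variable {R : Type u} [CommRing R]

lemma Function.Exact.finite_of_isNoetherianRing [IsNoetherianRing R] {X Y Z : Type*}
    [AddCommGroup X] [Module R X] [AddCommGroup Y] [Module R Y] [AddCommGroup Z] [Module R Z]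
    {f : X →ₗ[R] Y} {g : Y →ₗ[R] Z} (h : Function.Exact f g)
    (hX : Module.Finite R X) (hZ : Module.Finite R Z) : Module.Finite R Y := by
  have : IsNoetherian R Y := isNoetherian_of_range_eq_ker f g h.linearMap_ker_eq.symm
  infer_instance

/-- `Ext^i_R(R ⧸ I, X)` is finitely generated. -/
abbrev ExtFinite (I : Ideal R) (i : ℕ) (X : Type u) [AddCommGroup X] [Module R X] : Prop :=
  Module.Finite R (Abelian.Ext (ModuleCat.of R (R ⧸ I)) (ModuleCat.of R X) i)

variable {I : Ideal R} {X Y Z : Type u} [AddCommGroup X] [Module R X] [AddCommGroup Y] [Module R Y]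
  [AddCommGroup Z] [Module R Z]

lemma ExtFinite.congr {i : ℕ} (h : ExtFinite I i X) (e : X ≃ₗ[R] Y) : ExtFinite I i Y :=
  have := h
  Module.Finite.equiv (extCongr _ i e)

/-- `Ext^0_R(R ⧸ I, X)` is the submodule of `X` killed by `I`. -/
lemma nonempty_extZero_equiv (I : Ideal R) (X : Type u) [AddCommGroup X] [Module R X] :
    Nonempty (Abelian.Ext (ModuleCat.of R (R ⧸ I)) (ModuleCat.of R X) 0 ≃ₗ[R]
      Submodule.torsionBySet R X (I : Set R)) := by
  let F : ((R ⧸ I) →ₗ[R] X) →ₗ[R] Submodule.torsionBySet R X (I : Set R) :=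
    (LinearMap.applyₗ (1 : R ⧸ I)).codRestrict _ fun φ => by
      rw [Submodule.mem_torsionBySet_iff]
      rintro ⟨r, hr⟩
      change r • φ 1 = 0
      rw [← map_smul, Algebra.smul_def, mul_one, Ideal.Quotient.algebraMap_eq,
        Ideal.Quotient.eq_zero_iff_mem.2 hr, map_zero]
  have hF : Function.Bijective F := by
    constructor
    · intro φ ψ h
      refine Submodule.linearMap_qext _ (LinearMap.ext_ring ?_)
      exact congrArg Subtype.val h
    · rintro ⟨x, hx⟩
      refine ⟨I.liftQ (LinearMap.toSpanSingleton R X x) fun r hr =>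
        (Submodule.mem_torsionBySet_iff _ _).1 hx ⟨r, hr⟩, Subtype.ext ?_⟩
      exact one_smul R x
  exact ⟨Abelian.Ext.linearEquiv₀.trans
    (ModuleCat.homLinearEquiv.trans (LinearEquiv.ofBijective F hF))⟩

lemma extFinite_zero_iff :
    ExtFinite I 0 X ↔ Module.Finite R (Submodule.torsionBySet R X (I : Set R)) := by
  obtain ⟨e⟩ := nonempty_extZero_equiv I X
  exact Module.Finite.equiv_iff e

variable [IsNoetherianRing R] {f : X →ₗ[R] Y} {g : Y →ₗ[R] Z}

lemma extFinite_of_finite [Module.Finite R X] (i : ℕ) : ExtFinite I i X := inferInstance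

lemma ExtFinite.of_injective (h : ExtFinite I 0 Y) (hf : Function.Injective f) :
    ExtFinite I 0 X :=
  have := h
  Module.Finite.of_injective _ (extMap_zero_injective _ hf)

lemma ExtFinite.middle {i : ℕ} (hX : ExtFinite I i X) (hZ : ExtFinite I i Z)
    (hf : Function.Injective f) (hfg : Function.Exact f g) (hg : Function.Surjective g) :
    ExtFinite I i Y :=
  (exact_extMap_extMap _ hf hfg hg i).finite_of_isNoetherianRing hX hZ

lemma ExtFinite.right {i : ℕ} (hY : ExtFinite I i Y) (hX : ExtFinite I (i + 1) X)
    (hf : Function.Injective f) (hfg : Function.Exact f g) (hg : Function.Surjective g) :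
    ExtFinite I i Z :=
  (exact_extMap_extδ _ hf hfg hg i).finite_of_isNoetherianRing hY hX

lemma ExtFinite.left {i : ℕ} (hZ : ExtFinite I i Z) (hY : ExtFinite I (i + 1) Y)
    (hf : Function.Injective f) (hfg : Function.Exact f g) (hg : Function.Surjective g) :
    ExtFinite I (i + 1) X :=
  (exact_extδ_extMap _ hf hfg hg i).finite_of_isNoetherianRing hZ hY

/-- Melkersson's criterion: finiteness of `Ext(R ⧸ I, X)` can be checked on the kernel and the
cokernel of multiplication by an element of `I`. -/
lemma extFinite_of_ker_of_coker {x : R} (hx : x ∈ I)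
    (hker : ∀ i, ExtFinite I i (LinearMap.ker (LinearMap.lsmul R X x)))
    (hcoker : ∀ i, ExtFinite I i (X ⧸ LinearMap.range (LinearMap.lsmul R X x))) (i : ℕ) :
    ExtFinite I i X := by
  let μ := LinearMap.lsmul R X x
  have hπ : Function.Surjective μ.rangeRestrict := μ.surjective_rangeRestrict
  have hex : Function.Exact (LinearMap.ker μ).subtype μ.rangeRestrict := by
    rw [LinearMap.exact_iff, LinearMap.ker_rangeRestrict, Submodule.range_subtype]
  have hex' : Function.Exact (LinearMap.range μ).subtype (LinearMap.range μ).mkQ := by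
    rw [LinearMap.exact_iff, Submodule.ker_mkQ, Submodule.range_subtype]
  let N := ModuleCat.of R (R ⧸ I)
  have hzero (α) : extMap N i (LinearMap.range μ).subtype (extMap N i μ.rangeRestrict α) = 0 := by
    rw [← LinearMap.comp_apply, ← extMap_comp]
    have : (LinearMap.range μ).subtype ∘ₗ μ.rangeRestrict = μ := rfl
    rw [this, extMap_lsmul]
    exact smul_ext_eq_zero (smul_id_quotient_eq_zero hx) α
  have hK : Module.Finite R (LinearMap.ker (extMap N i (LinearMap.range μ).subtype)) := by
    cases i with
    | zero =>
      rw [LinearMap.ker_eq_bot.2 (extMap_zero_injective N (Submodule.subtype_injective _))]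
      infer_instance
    | succ i =>
      have := hcoker i
      rw [(exact_extδ_extMap N (Submodule.subtype_injective _) hex'
        (Submodule.mkQ_surjective _) i).linearMap_ker_eq]
      exact Module.Finite.range (extδ N _ hex' _ i)
  let ρ : Abelian.Ext N (ModuleCat.of R X) i →ₗ[R]
      LinearMap.ker (extMap N i (LinearMap.range μ).subtype) :=
    (extMap N i μ.rangeRestrict).codRestrict _ hzero
  refine Function.Exact.finite_of_isNoetherianRing (f := extMap N i (LinearMap.ker μ).subtype)
    (g := ρ) ?_ (hker i) hK
  rw [LinearMap.exact_iff]
  exact (LinearMap.ker_codRestrict _ _ _).trans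
    (exact_extMap_extMap N (Submodule.subtype_injective _) hex hπ i).linearMap_ker_eq

end ExtFinite

section Torsion
variable {R : Type u} [CommRing R]

/-- Every element of `X` is killed by a power of each element of `I`. -/
def IsTorsionIdeal (I : Ideal R) (X : Type u) [AddCommGroup X] [Module R X] : Prop :=
  ∀ r ∈ I, ∀ m : X, ∃ k : ℕ, r ^ k • m = 0

variable {I : Ideal R} {X Y : Type u} [AddCommGroup X] [Module R X] [AddCommGroup Y] [Module R Y]

lemma IsTorsionIdeal.of_injective (h : IsTorsionIdeal I Y) {f : X →ₗ[R] Y}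
    (hf : Function.Injective f) : IsTorsionIdeal I X := fun r hr m => by
  obtain ⟨k, hk⟩ := h r hr (f m)
  exact ⟨k, hf (by rw [map_smul, hk, map_zero])⟩

lemma IsTorsionIdeal.of_surjective (h : IsTorsionIdeal I X) {f : X →ₗ[R] Y}
    (hf : Function.Surjective f) : IsTorsionIdeal I Y := fun r hr m => by
  obtain ⟨m, rfl⟩ := hf m
  obtain ⟨k, hk⟩ := h r hr m
  exact ⟨k, by rw [← map_smul, hk, map_zero]⟩

lemma exact_subtype_mkQ (W : Submodule R X) : Function.Exact W.subtype W.mkQ := by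
  rw [LinearMap.exact_iff, Submodule.ker_mkQ, Submodule.range_subtype]

lemma Submodule.finite_quotient_of_sup_eq_top {F V : Submodule R X} (hF : F.FG) (h : F ⊔ V = ⊤) :
    Module.Finite R (X ⧸ V) := by
  have : Module.Finite R F := Module.Finite.iff_fg.2 hF
  refine Module.Finite.of_surjective (V.mkQ ∘ₗ F.subtype) ?_
  rw [← LinearMap.range_eq_top, LinearMap.range_comp, Submodule.range_subtype]
  rwa [Submodule.map_mkQ_eq_top, sup_comm]

variable [IsNoetherianRing R]

lemma ExtFinite.isNoetherian_torsionBySet (h : ExtFinite I 0 X) :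
    IsNoetherian R (Submodule.torsionBySet R X (I : Set R)) :=
  have := extFinite_zero_iff.1 h
  inferInstance

lemma extFinite_of_support_isMaximal (ht : IsTorsionIdeal I X)
    (hmax : ∀ p ∈ Module.support R X, p.asIdeal.IsMaximal) (h0 : ExtFinite I 0 X) (i : ℕ) :
    ExtFinite I i X := by
  have hI : I.FG := (isNoetherianRing_iff_ideal_fg R).1 ‹_› I
  have hart : IsArtinian R X := by
    refine isArtinian_of_torsionBySet hI ht ?_
    have := extFinite_zero_iff.1 h0
    exact isArtinian_of_support_isMaximal fun p hp =>
      hmax p (Module.support_subset_of_injective (Submodule.subtype _)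
        (Submodule.subtype_injective _) hp)
  have key (W : Submodule R X) : ∀ i, ExtFinite I i W := by
    induction W using WellFoundedLT.induction with
    | ind W ih =>
    have hW0 : ExtFinite I 0 W := h0.of_injective W.subtype_injective
    obtain ⟨x, hx, F, hF, htop⟩ := exists_sup_range_lsmul_eq_top (R := R) (Y := W) hI
      fun V k hV => fg_of_pow_le_annihilator hW0.isNoetherian_torsionBySet V
        (by rwa [Algebra.algebraMap_self, Ideal.map_id] at hV)
    replace htop : F ⊔ LinearMap.range (LinearMap.lsmul R W x) = ⊤ := htop
    let K := LinearMap.ker (LinearMap.lsmul R W x)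
    have hle : K.map W.subtype ≤ W := Submodule.map_subtype_le W K
    rcases hle.lt_or_eq with hlt | heq
    · refine extFinite_of_ker_of_coker hx (fun i => ?_) fun i => ?_
      · exact (ih _ hlt i).congr (Submodule.equivMapOfInjective _ W.subtype_injective K).symm
      · have := Submodule.finite_quotient_of_sup_eq_top hF htop
        exact extFinite_of_finite i
    · have hK : LinearMap.lsmul R W x = 0 := by
        rw [← LinearMap.ker_eq_top]
        refine Submodule.map_injective_of_injective W.subtype_injective ?_
        rw [Submodule.map_subtype_top]
        exact heq
      rw [hK, LinearMap.range_zero, sup_bot_eq] at htop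
      have : Module.Finite R W := ⟨htop ▸ hF⟩
      exact fun i => extFinite_of_finite i
  exact (key ⊤ i).congr Submodule.topEquiv

lemma extFinite_of_support_quotient_isMaximal (ht : IsTorsionIdeal I X) {F : Submodule R X}
    (hF : F.FG) (hmax : ∀ p ∈ Module.support R (X ⧸ F), p.asIdeal.IsMaximal)
    (h0 : ExtFinite I 0 X) (i : ℕ) : ExtFinite I i X := by
  have : Module.Finite R F := Module.Finite.iff_fg.2 hF
  have hQ := extFinite_of_support_isMaximal (ht.of_surjective F.mkQ_surjective) hmax
    (h0.right (extFinite_of_finite 1) F.subtype_injective (exact_subtype_mkQ F) F.mkQ_surjective)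
  exact (extFinite_of_finite i).middle (hQ i) F.subtype_injective (exact_subtype_mkQ F)
    F.mkQ_surjective

lemma mem_associatedPrimes_of_minimal_support {p : PrimeSpectrum R} (hp : p ∈ Module.support R X)
    (hmin : ∀ q ∈ Module.support R X, ¬ q < p) : p.asIdeal ∈ associatedPrimes R X := by
  obtain ⟨m, hm⟩ := Module.mem_support_iff_exists_annihilator.1 hp
  let V := Submodule.span R {m}
  have hfin : Module.Finite R V := Module.Finite.iff_fg.2 (Submodule.fg_span_singleton m)
  refine associatedPrimes.subset_of_injective V.subtype_injective ?_
  refine Module.associatedPrimes.minimalPrimes_annihilator_subset_associatedPrimes R V ?_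
  refine ⟨⟨p.2, hm⟩, fun q hq hqp => ?_⟩
  by_contra hcon
  exact hmin ⟨q, hq.1⟩ (Module.mem_support_iff_exists_annihilator.2 ⟨m, hq.2⟩) ⟨hqp, hcon⟩

end Torsion

section Localize
variable {R : Type u} [CommRing R] {I : Ideal R}
  {X : Type u} [AddCommGroup X] [Module R X]

variable (R X) in
/-- The support of `X` contains no chain of three primes. -/
def NoSupportChain : Prop :=
  ∀ p q r : PrimeSpectrum R, p ∈ Module.support R X → p < q → q < r → False

lemma PrimeSpectrum.exists_lt_of_not_isMaximal {p : PrimeSpectrum R}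
    (hp : ¬ p.asIdeal.IsMaximal) : ∃ m : PrimeSpectrum R, p < m ∧ m.asIdeal.IsMaximal := by
  obtain ⟨m, hm, hpm⟩ := p.asIdeal.exists_le_maximal p.2.ne_top
  refine ⟨⟨m, hm.isPrime⟩, lt_of_le_of_ne hpm ?_, hm⟩
  rintro rfl
  exact hp hm

variable [IsNoetherianRing R]

lemma exists_submonoid_of_noSupportChain (ht : IsTorsionIdeal I X) (h0 : ExtFinite I 0 X)
    (hX : NoSupportChain R X) : ∃ T : Submonoid R,
      (∀ (W : Type u) [AddCommGroup W] [Module R W], Module.support R W ⊆ Module.support R X →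
        (∀ w : W, ∃ t ∈ T, t • w = 0) → ∀ p ∈ Module.support R W, p.asIdeal.IsMaximal) ∧
      (∀ p q : PrimeSpectrum R, p ∈ Module.support R X → p < q →
        ∃ t ∈ T, t ∈ q.asIdeal) := by
  classical
  let X₁ := Submodule.torsionBySet R X (I : Set R)
  have hfin : Module.Finite R X₁ := extFinite_zero_iff.1 h0
  let S := (associatedPrimes.finite R X₁).toFinset.filter fun p => ¬ p.IsMaximal
  have hS (p : Ideal R) : p ∈ S ↔ p ∈ associatedPrimes R X₁ ∧ ¬ p.IsMaximal := by
    simp [S]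
  let T : Submonoid R :=
    { carrier := {r | ∀ p ∈ S, r ∉ p}
      one_mem' := fun p hp => (Ideal.ne_top_iff_one p).1 ((hS p).1 hp).1.isPrime.ne_top
      mul_mem' := fun {a b} ha hb p hp hab =>
        (((hS p).1 hp).1.isPrime.mem_or_mem hab).elim (ha p hp) (hb p hp) }
  refine ⟨T, fun W _ _ hWX hW p hp => ?_, fun p q hp hpq => ?_⟩
  · by_contra hmax
    obtain ⟨m, hpm, -⟩ := PrimeSpectrum.exists_lt_of_not_isMaximal hmax
    have hass := mem_associatedPrimes_of_minimal_support (hWX hp)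
      fun q hq hqp => hX q p m hq hqp hpm
    obtain ⟨w, hw⟩ := Module.mem_support_iff_exists_annihilator.1 hp
    obtain ⟨t, htT, htw⟩ := hW w
    refine htT p.asIdeal ((hS _).2 ⟨?_, hmax⟩)
      (hw ((Submodule.mem_annihilator_span_singleton _ _).2 htw))
    obtain ⟨-, y, hy⟩ := (isAssociatedPrime_iff).1 hass
    have hIp : I ≤ p.asIdeal := fun r hr => by
      obtain ⟨k, hk⟩ := ht r hr y
      refine p.2.mem_of_pow_mem k ?_
      rw [hy]
      exact Submodule.mem_colon_singleton.2 hk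
    have hyX : y ∈ X₁ := by
      rw [Submodule.mem_torsionBySet_iff]
      rintro ⟨r, hr⟩
      have := hIp hr
      rw [hy] at this
      exact Submodule.mem_colon_singleton.1 this
    refine (isAssociatedPrime_iff).2 ⟨p.2, ⟨y, hyX⟩, ?_⟩
    rw [hy]
    ext r
    simp [Submodule.mem_colon_singleton, Subtype.ext_iff]
  · by_contra! hcon
    have : (q.asIdeal : Set R) ⊆ ⋃ P ∈ (S : Set (Ideal R)), (id P : Ideal R) := by
      intro x hx
      by_contra hx'
      refine hcon x (fun P hP hxP => hx' (Set.mem_biUnion hP hxP)) hx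
    obtain ⟨P, hP, hqP⟩ := (Ideal.subset_union_prime (f := id) (⊥ : Ideal R) ⊥
      fun P hP _ _ => ((hS P).1 hP).1.isPrime).1 this
    obtain ⟨m, hm, -⟩ := PrimeSpectrum.exists_lt_of_not_isMaximal
      (p := ⟨P, ((hS P).1 hP).1.isPrime⟩) ((hS P).1 hP).2
    exact hX p ⟨P, ((hS P).1 hP).1.isPrime⟩ m hp (hpq.trans_le hqP) hm

variable (T : Submonoid R)

lemma fg_torsionBySet_localizedModule
    (h : (Submodule.torsionBySet R X (I : Set R)).FG) :
    (Submodule.torsionBySet (Localization T) (LocalizedModule T X)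
      (I.map (algebraMap R (Localization T)) : Set (Localization T))).FG := by
  classical
  let f := LocalizedModule.mkLinearMap T X
  let X₁ := Submodule.torsionBySet R X (I : Set R)
  have hfg : (X₁.localized T).FG := by
    obtain ⟨s, hs⟩ := h
    refine ⟨s.image f, ?_⟩
    change _ = Submodule.localized T (Submodule.torsionBySet R X (I : Set R))
    rw [← hs, Submodule.localized, Submodule.localized'_span, Finset.coe_image]
  have : IsNoetherian (Localization T) (X₁.localized T) := isNoetherian_of_fg_of_noetherian _ hfg
  refine isNoetherian_submodule.1 this _ fun ξ hξ => ?_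
  obtain ⟨⟨x, t⟩, rfl⟩ := IsLocalizedModule.mk'_surjective T f ξ
  obtain ⟨S, hS⟩ := (isNoetherianRing_iff_ideal_fg R).1 ‹_› I
  have hu : ∀ r : I, ∃ u : T, u • (r : R) • x = 0 := fun r => by
    have h1 := (Submodule.mem_torsionBySet_iff _ _).1 hξ
      ⟨algebraMap R (Localization T) r, Ideal.mem_map_of_mem _ r.2⟩
    change algebraMap R (Localization T) r • IsLocalizedModule.mk' f x t = 0 at h1
    rw [algebraMap_smul, ← IsLocalizedModule.mk'_smul, IsLocalizedModule.mk'_eq_zero'] at h1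
    exact h1
  choose u hu using hu
  let U : T := ∏ r : S, u ⟨r, hS ▸ Ideal.subset_span r.2⟩
  have hU : ∀ r ∈ I, U • r • x = 0 := by
    have hle : I ≤ (LinearMap.ker (LinearMap.toSpanSingleton R X (U • x))) := by
      rw [← hS, Ideal.span_le]
      intro r hr
      rw [SetLike.mem_coe, LinearMap.mem_ker, LinearMap.toSpanSingleton_apply]
      obtain ⟨v, hv⟩ := Finset.dvd_prod_of_mem
        (fun r : S => u ⟨r, hS ▸ Ideal.subset_span r.2⟩) (Finset.mem_univ ⟨r, hr⟩)
      change U = _ * v at hv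
      rw [smul_comm, hv, mul_comm, mul_smul, hu ⟨r, _⟩, smul_zero]
    intro r hr
    have := hle hr
    rwa [LinearMap.mem_ker, LinearMap.toSpanSingleton_apply, smul_comm] at this
  refine ⟨U • x, ?_, U * t, ?_⟩
  · rw [Submodule.mem_torsionBySet_iff]
    rintro ⟨r, hr⟩
    rw [smul_comm]
    exact hU r hr
  · exact IsLocalizedModule.mk'_cancel_left f x U t

lemma isArtinian_localizedModule (ht : IsTorsionIdeal I X)
    (h : (Submodule.torsionBySet R X (I : Set R)).FG)
    (hT : ∀ p q : PrimeSpectrum R, p ∈ Module.support R X → p < q → ∃ t ∈ T, t ∈ q.asIdeal) :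
    IsArtinian (Localization T) (LocalizedModule T X) := by
  have hI : I.FG := (isNoetherianRing_iff_ideal_fg R).1 ‹_› I
  let f := LocalizedModule.mkLinearMap T X
  have hNoeth : IsNoetherianRing (Localization T) := IsLocalization.isNoetherianRing T _ ‹_›
  let J := Submodule.torsionBySet (Localization T) (LocalizedModule T X)
      (I.map (algebraMap R (Localization T)) : Set (Localization T))
  have hJ : Module.Finite (Localization T) J :=
    Module.Finite.iff_fg.2 (fg_torsionBySet_localizedModule T h)
  have hIA : (I.map (algebraMap R (Localization T))).FG := hI.map _
  refine isArtinian_of_torsionBySet hIA ?_ (isArtinian_of_support_isMaximal (X := J) ?_)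
  · intro a ha ξ
    obtain ⟨⟨x, t⟩, rfl⟩ := IsLocalizedModule.mk'_surjective T f ξ
    rw [IsLocalization.mem_map_algebraMap_iff T] at ha
    obtain ⟨⟨⟨r, hr⟩, s⟩, hs⟩ := ha
    obtain ⟨k, hk⟩ := ht r hr x
    refine ⟨k, ?_⟩
    have h1 : (algebraMap R (Localization T) s) ^ k • a ^ k • IsLocalizedModule.mk' f x t = 0 := by
      rw [← mul_smul, ← mul_pow, mul_comm, hs, ← map_pow, algebraMap_smul,
        ← IsLocalizedModule.mk'_smul, hk, IsLocalizedModule.mk'_zero]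
    have hunit : IsUnit (algebraMap R (Localization T) s ^ k) :=
      (IsLocalization.map_units (Localization T) s).pow k
    exact (hunit.smul_eq_zero).1 h1
  · intro P hP
    by_contra hmax
    obtain ⟨Q, hPQ, -⟩ := PrimeSpectrum.exists_lt_of_not_isMaximal hmax
    have hcomap : PrimeSpectrum.comap (algebraMap R (Localization T)) P <
        PrimeSpectrum.comap (algebraMap R (Localization T)) Q := by
      refine lt_of_le_of_ne (Ideal.comap_mono hPQ.le) fun heq => hPQ.ne ?_
      exact PrimeSpectrum.localization_comap_injective (Localization T) T heq
    obtain ⟨⟨ξ, hξ⟩, hξP⟩ := Module.mem_support_iff_exists_annihilator.1 hP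
    obtain ⟨⟨x, t⟩, rfl⟩ := IsLocalizedModule.mk'_surjective T f ξ
    obtain ⟨t, htT, htQ⟩ := hT _ _ (Module.mem_support_iff_exists_annihilator.2 ⟨x, fun r hr => by
      refine hξP ?_
      rw [Submodule.mem_annihilator_span_singleton] at hr ⊢
      refine Subtype.ext ?_
      change algebraMap R (Localization T) r • IsLocalizedModule.mk' f x _ = 0
      rw [algebraMap_smul, ← IsLocalizedModule.mk'_smul, hr, IsLocalizedModule.mk'_zero]⟩) hcomap
    exact Q.2.ne_top (Ideal.eq_top_of_isUnit_mem _ htQ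
      (IsLocalization.map_units (Localization T) ⟨t, htT⟩))

end Localize

section Localize
variable {R : Type u} [CommRing R] {X : Type u} [AddCommGroup X] [Module R X] {T : Submonoid R}

lemma Submodule.exists_fg_localized_eq {W : Submodule R X}
    {F : Submodule (Localization T) (LocalizedModule T X)} (hF : F.FG) (hFW : F ≤ W.localized T) :
    ∃ F₀ ≤ W, F₀.FG ∧ F₀.localized T = F := by
  induction F, hF using Submodule.fg_induction with
  | singleton ξ =>
    obtain ⟨w, hw, t, rfl⟩ := hFW (Submodule.mem_span_singleton_self ξ)
    refine ⟨Submodule.span R {w}, by simpa using hw, Submodule.fg_span_singleton w, ?_⟩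
    refine le_antisymm ?_ ?_
    · rw [Submodule.localized, Submodule.localized'_span, Submodule.span_le, Set.image_singleton,
        Set.singleton_subset_iff]
      have h1 := Submodule.smul_mem
        (Submodule.span (Localization T)
          {IsLocalizedModule.mk' (LocalizedModule.mkLinearMap T X) w t})
        (algebraMap R (Localization T) t) (Submodule.mem_span_singleton_self _)
      rwa [algebraMap_smul, ← IsLocalizedModule.mk'_smul, ← Submonoid.smul_def,
        IsLocalizedModule.mk'_cancel] at h1
    · rw [Submodule.span_le, Set.singleton_subset_iff]
      exact ⟨w, Submodule.mem_span_singleton_self w, t, rfl⟩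
  | sup F₁ F₂ h₁ h₂ ih₁ ih₂ =>
    obtain ⟨V₁, hV₁, hf₁, rfl⟩ := ih₁ (le_sup_left.trans hFW)
    obtain ⟨V₂, hV₂, hf₂, rfl⟩ := ih₂ (le_sup_right.trans hFW)
    exact ⟨V₁ ⊔ V₂, sup_le hV₁ hV₂, hf₁.sup hf₂,
      (Submodule.localized'gi (Localization T) T (LocalizedModule.mkLinearMap T X)).gc.l_sup⟩

lemma Submodule.exists_smul_mem_of_localized_le {U W : Submodule R X}
    (h : W.localized T ≤ U.localized T) {w : X} (hw : w ∈ W) : ∃ t ∈ T, t • w ∈ U := by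
  obtain ⟨u, hu, s, hs⟩ := h ⟨w, hw, 1, rfl⟩
  rw [IsLocalizedModule.mk'_eq_mk'_iff] at hs
  obtain ⟨c, hc⟩ := hs
  rw [one_smul] at hc
  refine ⟨c * s, T.mul_mem c.2 s.2, ?_⟩
  rw [mul_smul]
  change c • s • w ∈ U
  rw [hc]
  exact U.smul_mem _ hu

variable [IsNoetherianRing R] {I : Ideal R}

lemma extFinite_of_noSupportChain (ht : IsTorsionIdeal I X) (hX : NoSupportChain R X)
    (h0 : ExtFinite I 0 X) (h1 : ExtFinite I 1 X) (i : ℕ) : ExtFinite I i X := by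
  have hI : I.FG := (isNoetherianRing_iff_ideal_fg R).1 ‹_› I
  obtain ⟨T, hTmax, hT⟩ := exists_submonoid_of_noSupportChain ht h0 hX
  have hfin := extFinite_zero_iff.1 h0
  rw [Module.Finite.iff_fg] at hfin
  have hart := isArtinian_localizedModule T ht hfin hT
  have hNoeth : IsNoetherianRing (Localization T) := IsLocalization.isNoetherianRing T _ ‹_›
  have hJ := fg_torsionBySet_localizedModule T hfin
  let f := LocalizedModule.mkLinearMap T X
  have key (W : Submodule R X) (hW1 : ExtFinite I 1 W) : ∀ i, ExtFinite I i W := by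
    induction W using (InvImage.wf (fun W : Submodule R X => W.localized T)
      (wellFounded_lt (α := Submodule (Localization T) (LocalizedModule T X)))).induction with
    | _ W ih =>
    have hW0 : ExtFinite I 0 W := h0.of_injective W.subtype_injective
    have htW : IsTorsionIdeal I W := ht.of_injective W.subtype_injective
    have hsW : Module.support R W ⊆ Module.support R X :=
      Module.support_subset_of_injective W.subtype W.subtype_injective
    have hNoethJ : IsNoetherian (Localization T) (Submodule.torsionBySet (Localization T)
        (W.localized T) (I.map (algebraMap R (Localization T)) : Set (Localization T))) := by
      have := isNoetherian_of_fg_of_noetherian _ hJ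
      refine isNoetherian_of_injective (((W.localized T).subtype ∘ₗ
        (Submodule.torsionBySet (Localization T) (W.localized T)
          (I.map (algebraMap R (Localization T)) : Set (Localization T))).subtype).codRestrict
        (Submodule.torsionBySet (Localization T) (LocalizedModule T X)
          (I.map (algebraMap R (Localization T)) : Set (Localization T))) fun z => ?_) ?_
      · rw [Submodule.mem_torsionBySet_iff]
        intro a
        exact congrArg Subtype.val ((Submodule.mem_torsionBySet_iff _ _).1 z.2 a)
      · intro a b hab
        have := congrArg Subtype.val hab
        exact Subtype.ext (Subtype.ext this)
    obtain ⟨x, hx, F, hF, htop⟩ := exists_sup_range_lsmul_eq_top (A := Localization T)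
      (Y := W.localized T) hI fun V k hV => fg_of_pow_le_annihilator hNoethJ V hV
    obtain ⟨F₀, hF₀W, hF₀, hF₀F⟩ := Submodule.exists_fg_localized_eq (T := T) (hF.map _)
      (Submodule.map_subtype_le (W.localized T) F)
    let V := LinearMap.range (LinearMap.lsmul R W x)
    let K := LinearMap.ker (LinearMap.lsmul R W x)
    let F₁ : Submodule R W := F₀.comap W.subtype
    have hF₁ : F₁.FG := by
      refine Submodule.fg_of_fg_map_injective W.subtype W.subtype_injective ?_
      rwa [Submodule.map_comap_subtype, inf_eq_right.2 hF₀W]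
    have hmem (w : W) : ∃ t ∈ T, t • w ∈ F₁ ⊔ V := by
      have hle : W.localized T ≤ (F₀ ⊔ W.map (LinearMap.lsmul R X x)).localized T := by
        intro ξ hξ
        have h2 : (⟨ξ, hξ⟩ : W.localized T) ∈ (⊤ : Submodule (Localization T) (W.localized T)) :=
          Submodule.mem_top
        rw [← htop, Submodule.mem_sup] at h2
        obtain ⟨a, ha, _, ⟨⟨_, w', hw', s, rfl⟩, rfl⟩, hab⟩ := h2
        have hab' := congrArg Subtype.val hab
        rw [← show _ = ξ from hab']
        refine Submodule.add_mem _ ?_ ⟨x • w', Submodule.mem_sup_right ⟨w', hw', rfl⟩, s, ?_⟩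
        · have : (a : LocalizedModule T X) ∈ F₀.localized T := hF₀F ▸ ⟨a, ha, rfl⟩
          obtain ⟨u, hu, s', hs'⟩ := this
          exact ⟨u, Submodule.mem_sup_left hu, s', hs'⟩
        · rw [IsLocalizedModule.mk'_smul]
          exact (algebraMap_smul (Localization T) x _).symm
      obtain ⟨t, htT, h⟩ := Submodule.exists_smul_mem_of_localized_le hle w.2
      refine ⟨t, htT, ?_⟩
      obtain ⟨a, ha, _, ⟨b, hb, rfl⟩, hab⟩ := Submodule.mem_sup.1 h
      exact Submodule.mem_sup.2 ⟨⟨a, hF₀W ha⟩, ha, _, ⟨⟨b, hb⟩, rfl⟩, Subtype.ext hab⟩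
    have hexK : Function.Exact K.subtype (LinearMap.lsmul R W x).rangeRestrict := by
      rw [LinearMap.exact_iff, LinearMap.ker_rangeRestrict, Submodule.range_subtype]
    have hsurj := (LinearMap.lsmul R W x).surjective_rangeRestrict
    by_cases hlt : (K.map W.subtype).localized T < W.localized T
    · have hV0 : ExtFinite I 0 V := hW0.of_injective V.subtype_injective
      have hK1 : ExtFinite I 1 K := hV0.left hW1 K.subtype_injective hexK hsurj
      let e := Submodule.equivMapOfInjective W.subtype W.subtype_injective K
      have hK (i) : ExtFinite I i K := (ih _ hlt (hK1.congr e) i).congr e.symm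
      have hV1 : ExtFinite I 1 V := hW1.right (hK 2) K.subtype_injective hexK hsurj
      have hQ0 : ExtFinite I 0 (W ⧸ V) :=
        hW0.right hV1 V.subtype_injective (exact_subtype_mkQ V) V.mkQ_surjective
      refine extFinite_of_ker_of_coker hx hK fun i => ?_
      refine extFinite_of_support_quotient_isMaximal (htW.of_surjective V.mkQ_surjective)
        (hF₁.map V.mkQ) (hTmax _ ?_ fun z => ?_) hQ0 i
      · exact ((Module.support_subset_of_surjective _ (Submodule.mkQ_surjective _)).trans
          (Module.support_subset_of_surjective _ V.mkQ_surjective)).trans hsW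
      · obtain ⟨z, rfl⟩ := Submodule.mkQ_surjective _ z
        obtain ⟨w, rfl⟩ := V.mkQ_surjective z
        obtain ⟨t, htT, h⟩ := hmem w
        obtain ⟨a, ha, b, hb, hab⟩ := Submodule.mem_sup.1 h
        refine ⟨t, htT, ?_⟩
        have hb0 : V.mkQ b = 0 := (Submodule.Quotient.mk_eq_zero V).2 hb
        rw [← map_smul, ← map_smul, ← hab, map_add, hb0, add_zero]
        exact (Submodule.Quotient.mk_eq_zero _).2 ⟨a, ha, rfl⟩
    · have hle : W.localized T ≤ (K.map W.subtype).localized T := by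
        by_contra hcon
        exact hlt ⟨(Submodule.localized'gi (Localization T) T
          (LocalizedModule.mkLinearMap T X)).gc.monotone_l (Submodule.map_subtype_le W K), hcon⟩
      refine extFinite_of_support_quotient_isMaximal htW hF₁ (hTmax _ ?_ fun z => ?_) hW0
      · exact (Module.support_subset_of_surjective _ F₁.mkQ_surjective).trans hsW
      · obtain ⟨w, rfl⟩ := F₁.mkQ_surjective z
        obtain ⟨t, htT, h⟩ := hmem w
        obtain ⟨a, ha, _, ⟨b, rfl⟩, hab⟩ := Submodule.mem_sup.1 h
        obtain ⟨s, hsT, c, hc, hcb⟩ := Submodule.exists_smul_mem_of_localized_le hle b.2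
        refine ⟨s * t, T.mul_mem hsT htT, ?_⟩
        have hsb : s • x • b = 0 := by
          rw [smul_comm, ← show c = s • b from Subtype.ext hcb]
          exact hc
        rw [← map_smul, mul_smul, ← hab, smul_add, LinearMap.lsmul_apply, hsb, add_zero]
        exact (Submodule.Quotient.mk_eq_zero _).2 (F₁.smul_mem s ha)
  exact (key ⊤ (h1.congr Submodule.topEquiv.symm) i).congr Submodule.topEquiv

/-- A torsion module whose `Ext⁰` and `Ext¹` are finitely generated has all `Extⁱ` finitely
generated, provided that it is `FD_{<2}`. -/
lemma extFinite_of_quotient_noSupportChain (ht : IsTorsionIdeal I X) {N : Submodule R X}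
    (hN : N.FG) (hX : NoSupportChain R (X ⧸ N)) (h0 : ExtFinite I 0 X) (h1 : ExtFinite I 1 X)
    (i : ℕ) : ExtFinite I i X := by
  have : Module.Finite R N := Module.Finite.iff_fg.2 hN
  have hQ (i) (hi : ExtFinite I i X) : ExtFinite I i (X ⧸ N) :=
    hi.right (extFinite_of_finite _) N.subtype_injective (exact_subtype_mkQ N) N.mkQ_surjective
  exact (extFinite_of_finite i).middle (extFinite_of_noSupportChain
    (ht.of_surjective N.mkQ_surjective) hX (hQ 0 h0) (hQ 1 h1) i) N.subtype_injective
    (exact_subtype_mkQ N) N.mkQ_surjective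

end Localize

section PowTorsion
variable {R : Type u} [CommRing R] (𝔞 : Ideal R) (X : Type u) [AddCommGroup X] [Module R X]

/-- The submodule `Γ_𝔞(X)` of elements killed by a power of `𝔞`. -/
def powTorsion : Submodule R X where
  carrier := {x | ∃ n : ℕ, ∀ r ∈ 𝔞 ^ n, r • x = 0}
  zero_mem' := ⟨0, fun _ _ => smul_zero _⟩
  add_mem' := by
    rintro x y ⟨m, hm⟩ ⟨n, hn⟩
    refine ⟨m + n, fun r hr => ?_⟩
    rw [smul_add, hm r (Ideal.pow_le_pow_right (Nat.le_add_right m n) hr),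
      hn r (Ideal.pow_le_pow_right (Nat.le_add_left n m) hr), add_zero]
  smul_mem' := by
    rintro s x ⟨n, hn⟩
    exact ⟨n, fun r hr => by rw [smul_comm, hn r hr, smul_zero]⟩

variable {𝔞 X} {Y : Type u} [AddCommGroup Y] [Module R Y]

lemma map_mem_powTorsion (f : X →ₗ[R] Y) {x : X} (hx : x ∈ powTorsion 𝔞 X) :
    f x ∈ powTorsion 𝔞 Y := by
  obtain ⟨n, hn⟩ := hx
  exact ⟨n, fun r hr => by rw [← map_smul, hn r hr, map_zero]⟩

lemma mem_powTorsion_of_map_mem {f : X →ₗ[R] Y} (hf : Function.Injective f) {x : X}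
    (hx : f x ∈ powTorsion 𝔞 Y) : x ∈ powTorsion 𝔞 X := by
  obtain ⟨n, hn⟩ := hx
  exact ⟨n, fun r hr => hf (by rw [map_smul, hn r hr, map_zero])⟩

lemma powTorsion_powTorsion : powTorsion 𝔞 (powTorsion 𝔞 X) = ⊤ :=
  eq_top_iff.2 fun x _ => mem_powTorsion_of_map_mem (Submodule.subtype_injective _) x.2

lemma powTorsion_eq_top_of_surjective (h : powTorsion 𝔞 X = ⊤) {f : X →ₗ[R] Y}
    (hf : Function.Surjective f) : powTorsion 𝔞 Y = ⊤ := by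
  refine eq_top_iff.2 fun y _ => ?_
  obtain ⟨x, rfl⟩ := hf y
  exact map_mem_powTorsion f (h ▸ Submodule.mem_top)

lemma isTorsionIdeal_of_powTorsion_eq_top (h : powTorsion 𝔞 X = ⊤) : IsTorsionIdeal 𝔞 X := by
  intro r hr x
  obtain ⟨n, hn⟩ : x ∈ powTorsion 𝔞 X := h ▸ Submodule.mem_top
  exact ⟨n, hn _ (Ideal.pow_mem_pow hr n)⟩

lemma IsTorsionIdeal.support_subset (h : IsTorsionIdeal 𝔞 X) :
    Module.support R X ⊆ PrimeSpectrum.zeroLocus (𝔞 : Set R) := by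
  intro p hp r hr
  obtain ⟨x, hx⟩ := Module.mem_support_iff_exists_annihilator.1 hp
  obtain ⟨k, hk⟩ := h r hr x
  exact p.2.mem_of_pow_mem k (hx (by
    rw [Submodule.mem_annihilator_span_singleton]
    exact hk))

lemma exists_pow_smul_eq_zero_of_fg {W : Submodule R X} (hW : W.FG) (h : W ≤ powTorsion 𝔞 X) :
    ∃ n : ℕ, ∀ x ∈ W, ∀ r ∈ 𝔞 ^ n, r • x = 0 := by
  induction W, hW using Submodule.fg_induction with
  | singleton x =>
    obtain ⟨n, hn⟩ := h (Submodule.mem_span_singleton_self x)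
    refine ⟨n, fun y hy r hr => ?_⟩
    obtain ⟨s, rfl⟩ := Submodule.mem_span_singleton.1 hy
    rw [smul_comm, hn r hr, smul_zero]
  | sup W V hW hV hW' hV' =>
    obtain ⟨m, hm⟩ := hW' (le_sup_left.trans h)
    obtain ⟨n, hn⟩ := hV' (le_sup_right.trans h)
    refine ⟨m + n, fun y hy r hr => ?_⟩
    obtain ⟨w, hw, v, hv, rfl⟩ := Submodule.mem_sup.1 hy
    rw [smul_add, hm w hw r (Ideal.pow_le_pow_right (Nat.le_add_right m n) hr),
      hn v hv r (Ideal.pow_le_pow_right (Nat.le_add_left n m) hr), add_zero]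

lemma Module.Injective.exists_comp_eq [Module.Injective R X] {J P : Type u} [AddCommGroup J]
    [Module R J] [AddCommGroup P] [Module R P] (φ : J →ₗ[R] P) (f : J →ₗ[R] X)
    (h : LinearMap.ker φ ≤ LinearMap.ker f) : ∃ g : P →ₗ[R] X, g ∘ₗ φ = f := by
  obtain ⟨g, hg⟩ := (Module.Baer.of_injective ‹Module.Injective R X›).extension_property
    ((LinearMap.ker φ).liftQ φ le_rfl)
    (LinearMap.ker_eq_bot.1 (Submodule.ker_liftQ_eq_bot' _ _ rfl))
    ((LinearMap.ker φ).liftQ f h)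
  exact ⟨g, LinearMap.ext fun x => congr($hg (Submodule.Quotient.mk x))⟩

variable [IsNoetherianRing R]

lemma powTorsion_quotient_powTorsion : powTorsion 𝔞 (X ⧸ powTorsion 𝔞 X) = ⊥ := by
  refine eq_bot_iff.2 fun z hz => ?_
  obtain ⟨x, rfl⟩ := Submodule.mkQ_surjective _ z
  obtain ⟨n, hn⟩ := hz
  have hfg : (Submodule.map (LinearMap.toSpanSingleton R X x) (𝔞 ^ n)).FG :=
    (IsNoetherian.noetherian (𝔞 ^ n)).map _
  obtain ⟨m, hm⟩ := exists_pow_smul_eq_zero_of_fg hfg (by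
    rintro _ ⟨r, hr, rfl⟩
    have := hn r hr
    rw [← map_smul] at this
    exact (Submodule.Quotient.mk_eq_zero _).1 this)
  refine (Submodule.Quotient.mk_eq_zero _).2 ⟨m + n, fun r hr => ?_⟩
  rw [pow_add] at hr
  refine Submodule.mul_induction_on hr (fun s hs t ht => ?_) fun s t hs ht => ?_
  · rw [mul_smul]
    exact hm _ ⟨t, ht, rfl⟩ s hs
  · rw [add_smul, hs, ht, add_zero]

lemma injective_powTorsion [Module.Injective R X] : Module.Injective R (powTorsion 𝔞 X) := by
  refine Module.Baer.injective fun J f => ?_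
  let f' : J →ₗ[R] X := (powTorsion 𝔞 X).subtype ∘ₗ f
  obtain ⟨m, hm⟩ := exists_pow_smul_eq_zero_of_fg (𝔞 := 𝔞)
    (W := LinearMap.range f') (by
      rw [LinearMap.range_eq_map]
      exact (Module.Finite.fg_top).map _) (by
      rintro _ ⟨x, rfl⟩
      exact (f x).2)
  obtain ⟨k, hk⟩ := 𝔞.exists_pow_inf_eq_pow_smul (J : Submodule R R)
  have hk' := hk (m + k) (Nat.le_add_left k m)
  let φ : J →ₗ[R] R ⧸ 𝔞 ^ (m + k) := (𝔞 ^ (m + k)).mkQ ∘ₗ J.subtype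
  have hφ : LinearMap.ker φ ≤ LinearMap.ker f' := by
    intro x hx
    have hx' : (x : R) ∈ 𝔞 ^ (m + k) := (Submodule.Quotient.mk_eq_zero _).1 hx
    have h1 : (x : R) ∈ 𝔞 ^ m • (𝔞 ^ k • ⊤ ⊓ J : Submodule R R) := by
      rw [Nat.add_sub_cancel] at hk'
      rw [← hk']
      exact ⟨by simpa using hx', x.2⟩
    have h2 : ∀ y ∈ 𝔞 ^ m • (𝔞 ^ k • ⊤ ⊓ J : Submodule R R), ∃ h : y ∈ J, f' ⟨y, h⟩ = 0 := by
      intro y hy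
      refine Submodule.smul_induction_on hy (fun r hr z hz => ?_) ?_
      · refine ⟨J.smul_mem r hz.2, ?_⟩
        exact (map_smul f' r ⟨z, hz.2⟩).trans (hm _ ⟨_, rfl⟩ r hr)
      · rintro y z ⟨hy, hy'⟩ ⟨hz, hz'⟩
        refine ⟨J.add_mem hy hz, ?_⟩
        exact (map_add f' ⟨y, hy⟩ ⟨z, hz⟩).trans (by rw [hy', hz', add_zero])
    exact (h2 _ h1).2
  obtain ⟨g, hg⟩ := Module.Injective.exists_comp_eq φ f' hφ
  refine ⟨LinearMap.toSpanSingleton R _ ⟨g 1, m + k, fun r hr => ?_⟩, fun x hx => Subtype.ext ?_⟩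
  · rw [← map_smul, Algebra.smul_def, mul_one, Ideal.Quotient.algebraMap_eq,
      Ideal.Quotient.eq_zero_iff_mem.2 hr, map_zero]
  · refine Eq.trans ?_ congr($hg ⟨x, hx⟩)
    change x • g 1 = g (Submodule.Quotient.mk x)
    rw [← map_smul, Algebra.smul_def, mul_one]
    rfl

end PowTorsion

section ExtLimit
variable {R : Type u} [CommRing R]

/-- Evaluation at `1`, as a map `Ext^0(R ⧸ J, X) → X`. -/
noncomputable def extEval (J : Ideal R) (X : Type u) [AddCommGroup X] [Module R X] :
    Abelian.Ext (ModuleCat.of R (R ⧸ J)) (ModuleCat.of R X) 0 →ₗ[R] X :=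
  LinearMap.applyₗ (1 : R ⧸ J) ∘ₗ
    (Abelian.Ext.linearEquiv₀.trans ModuleCat.homLinearEquiv).toLinearMap

variable {X Y Z : Type u} [AddCommGroup X] [Module R X] [AddCommGroup Y] [Module R Y]
  [AddCommGroup Z] [Module R Z] {J : Ideal R}

lemma extEval_mk₀ (φ : ModuleCat.of R (R ⧸ J) ⟶ ModuleCat.of R X) :
    extEval J X (Abelian.Ext.mk₀ φ) = φ 1 := by
  obtain ⟨α, rfl⟩ : ∃ α, Abelian.Ext.linearEquiv₀ (R := R) α = φ :=
    Abelian.Ext.linearEquiv₀.surjective φ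
  rw [Abelian.Ext.mk₀_linearEquiv₀_apply]
  rfl

lemma exists_mk₀_eq {N M : ModuleCat.{u} R} (α : Abelian.Ext N M 0) :
    ∃ φ, Abelian.Ext.mk₀ φ = α :=
  (Abelian.Ext.mk₀_bijective N M).2 α

lemma extEval_injective : Function.Injective (extEval J X) := by
  intro α β h
  obtain ⟨φ, rfl⟩ := exists_mk₀_eq α
  obtain ⟨ψ, rfl⟩ := exists_mk₀_eq β
  rw [extEval_mk₀, extEval_mk₀] at h
  congr 1
  refine ModuleCat.hom_ext (Submodule.linearMap_qext _ (LinearMap.ext_ring h))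

lemma smul_extEval {r : R} (hr : r ∈ J)
    (α : Abelian.Ext (ModuleCat.of R (R ⧸ J)) (ModuleCat.of R X) 0) :
    r • extEval J X α = 0 := by
  rw [← map_smul, smul_ext_eq_zero (smul_id_quotient_eq_zero hr), map_zero]

lemma exists_extEval_eq {x : X} (hx : ∀ r ∈ J, r • x = 0) : ∃ α, extEval J X α = x := by
  refine ⟨Abelian.Ext.mk₀ (ModuleCat.ofHom (J.liftQ (LinearMap.toSpanSingleton R X x) hx)), ?_⟩
  rw [extEval_mk₀]
  exact one_smul R x

lemma extEval_extMap (f : X →ₗ[R] Y)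
    (α : Abelian.Ext (ModuleCat.of R (R ⧸ J)) (ModuleCat.of R X) 0) :
    extEval J Y (extMap _ 0 f α) = f (extEval J X α) := by
  obtain ⟨φ, rfl⟩ := exists_mk₀_eq α
  rw [extMap_apply, Abelian.Ext.mk₀_comp_mk₀, extEval_mk₀, extEval_mk₀]
  rfl

variable (𝔞 : Ideal R)

lemma extEval_extPowMap {m n : ℕ} (h : m ≤ n)
    (α : Abelian.Ext (ModuleCat.of R (R ⧸ 𝔞 ^ m)) (ModuleCat.of R X) 0) :
    extEval (𝔞 ^ n) X (extPowMap 𝔞 _ 0 m n h α) = extEval (𝔞 ^ m) X α := by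
  obtain ⟨φ, rfl⟩ := exists_mk₀_eq α
  rw [extPowMap_apply, Abelian.Ext.mk₀_comp_mk₀, extEval_mk₀, extEval_mk₀]
  rfl

lemma extMap_extPowMap (f : X →ₗ[R] Y) (i : ℕ) {m n : ℕ} (h : m ≤ n)
    (α : Abelian.Ext (ModuleCat.of R (R ⧸ 𝔞 ^ m)) (ModuleCat.of R X) i) :
    extMap _ i f (extPowMap 𝔞 _ i m n h α) = extPowMap 𝔞 _ i m n h (extMap _ i f α) := by
  rw [extMap_apply, extMap_apply, extPowMap_apply, extPowMap_apply,
    Abelian.Ext.comp_assoc_of_third_deg_zero]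

lemma extδ_extPowMap {f : X →ₗ[R] Y} {g : Y →ₗ[R] Z} (hf : Function.Injective f)
    (hfg : Function.Exact f g) (hg : Function.Surjective g) (i : ℕ) {m n : ℕ} (h : m ≤ n)
    (α : Abelian.Ext (ModuleCat.of R (R ⧸ 𝔞 ^ m)) (ModuleCat.of R Z) i) :
    extδ _ hf hfg hg i (extPowMap 𝔞 _ i m n h α) =
      extPowMap 𝔞 _ (i + 1) m n h (extδ _ hf hfg hg i α) := by
  rw [extδ_apply, extδ_apply, extPowMap_apply, extPowMap_apply]
  exact Abelian.Ext.comp_assoc _ _ _ (zero_add i) rfl (by lia)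

/-- A morphism of sequential systems that is bijective up to passing further along the systems
induces an isomorphism on direct limits. -/
lemma nonempty_extLimit_equiv (M M' : ModuleCat.{u} R) (i j : ℕ)
    (φ : ∀ n, Abelian.Ext (ModuleCat.of R (R ⧸ 𝔞 ^ n)) M i →ₗ[R]
      Abelian.Ext (ModuleCat.of R (R ⧸ 𝔞 ^ n)) M' j)
    (hφ : ∀ m n (h : m ≤ n) α, φ n (extPowMap 𝔞 M i m n h α) = extPowMap 𝔞 M' j m n h (φ m α))
    (hinj : ∀ n α, φ n α = 0 → ∃ k, ∃ h : n ≤ k, extPowMap 𝔞 M i n k h α = 0)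
    (hsurj : ∀ n β, ∃ k, ∃ h : n ≤ k, ∃ α, φ k α = extPowMap 𝔞 M' j n k h β) :
    Nonempty (ExtLimit 𝔞 M i ≃ₗ[R] ExtLimit 𝔞 M' j) := by
  refine ⟨LinearEquiv.ofBijective (Module.DirectLimit.map φ fun m n h =>
    LinearMap.ext (hφ m n h)) ⟨?_, fun z => ?_⟩⟩
  · rw [injective_iff_map_eq_zero]
    intro z hz
    obtain ⟨n, α, rfl⟩ := Module.DirectLimit.exists_of z
    rw [Module.DirectLimit.map_apply_of] at hz
    obtain ⟨k, hk, h0⟩ := Module.DirectLimit.of.zero_exact hz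
    rw [← hφ] at h0
    obtain ⟨l, hl, h1⟩ := hinj _ _ h0
    rw [← Module.DirectLimit.of_f (hij := hk), ← Module.DirectLimit.of_f (hij := hl), h1, map_zero]
  · obtain ⟨n, β, rfl⟩ := Module.DirectLimit.exists_of z
    obtain ⟨k, hk, α, hα⟩ := hsurj n β
    exact ⟨Module.DirectLimit.of R ℕ _ _ k α, by
      rw [Module.DirectLimit.map_apply_of, hα, Module.DirectLimit.of_f]⟩

variable (X) in
lemma nonempty_extLimit_zero_equiv :
    Nonempty (ExtLimit 𝔞 (ModuleCat.of R X) 0 ≃ₗ[R] powTorsion 𝔞 X) := by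
  let φ (n : ℕ) : Abelian.Ext (ModuleCat.of R (R ⧸ 𝔞 ^ n)) (ModuleCat.of R X) 0 →ₗ[R]
      powTorsion 𝔞 X := (extEval (𝔞 ^ n) X).codRestrict _ fun α =>
    ⟨n, fun r hr => smul_extEval hr α⟩
  refine ⟨LinearEquiv.ofBijective (Module.DirectLimit.lift R ℕ _ _ φ fun m n h α =>
    Subtype.ext (extEval_extPowMap 𝔞 h α)) ⟨?_, ?_⟩⟩
  · exact Module.DirectLimit.lift_injective _ _ fun n α β h =>
      extEval_injective (congrArg Subtype.val h)
  · rintro ⟨x, n, hn⟩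
    obtain ⟨α, hα⟩ := exists_extEval_eq hn
    exact ⟨Module.DirectLimit.of R ℕ _ _ n α, by
      rw [Module.DirectLimit.lift_of]; exact Subtype.ext hα⟩

lemma powTorsion_extLimit (M : ModuleCat.{u} R) (i : ℕ) :
    powTorsion 𝔞 (ExtLimit 𝔞 M i) = ⊤ := by
  refine eq_top_iff.2 fun z _ => ?_
  obtain ⟨n, α, rfl⟩ := Module.DirectLimit.exists_of z
  exact ⟨n, fun r hr => by
    rw [← map_smul, smul_ext_eq_zero (smul_id_quotient_eq_zero hr), map_zero]⟩

variable (R X) in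
lemma exists_injective_module : ∃ (E : Type u) (_ : AddCommGroup E) (_ : Module R E)
    (f : X →ₗ[R] E), Module.Injective R E ∧ Function.Injective f := by
  obtain ⟨⟨J, hJ, f, hf⟩⟩ := EnoughInjectives.presentation (ModuleCat.of R X)
  exact ⟨J, _, _, f.hom, @Module.injective_module_of_injective_object R J _ _ _ hJ,
    (ModuleCat.mono_iff_injective _).1 hf⟩

lemma ext_eq_zero_of_injective {N : ModuleCat.{u} R} [Module.Injective R X] {i : ℕ}
    (α : Abelian.Ext N (ModuleCat.of R X) (i + 1)) : α = 0 :=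
  have := Module.injective_object_of_injective_module R X
  α.eq_zero_of_injective

variable {𝔞}

lemma ext_eq_zero_of_injective_quotient {N : ModuleCat.{u} R} {i : ℕ} [Module.Injective R Y]
    [Module.Injective R X] {f : X →ₗ[R] Y} {g : Y →ₗ[R] Z} (hf : Function.Injective f)
    (hfg : Function.Exact f g) (hg : Function.Surjective g)
    (α : Abelian.Ext N (ModuleCat.of R Z) (i + 1)) : α = 0 := by
  obtain ⟨β, rfl⟩ := (exact_extMap_extδ N hf hfg hg (i + 1) α).1 (ext_eq_zero_of_injective _)
  rw [ext_eq_zero_of_injective β, map_zero]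

variable [IsNoetherianRing R]

lemma exists_injective_module_powTorsion (hX : powTorsion 𝔞 X = ⊤) :
    ∃ (E : Type u) (_ : AddCommGroup E) (_ : Module R E) (f : X →ₗ[R] E),
      Module.Injective R E ∧ Function.Injective f ∧ powTorsion 𝔞 E = ⊤ := by
  obtain ⟨E, _, _, f, hE, hf⟩ := exists_injective_module R X
  exact ⟨powTorsion 𝔞 E, _, _,
    f.codRestrict _ fun x => map_mem_powTorsion f (hX ▸ Submodule.mem_top),
    injective_powTorsion, fun x y h => hf (congrArg Subtype.val h), powTorsion_powTorsion⟩

/-- The higher local cohomology of a torsion module vanishes. -/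
lemma exists_extPowMap_eq_zero (i : ℕ) : ∀ (X : Type u) [AddCommGroup X]
    [Module R X] (_ : powTorsion 𝔞 X = ⊤) (m : ℕ)
    (α : Abelian.Ext (ModuleCat.of R (R ⧸ 𝔞 ^ m)) (ModuleCat.of R X) (i + 1)),
    ∃ n, ∃ h : m ≤ n, extPowMap 𝔞 _ (i + 1) m n h α = 0 := by
  induction i with
  | zero =>
    intro X _ _ hX m α
    obtain ⟨E, _, _, f, hE, hf, ht⟩ := exists_injective_module_powTorsion hX
    have hfg := f.exact_map_mkQ_range
    have hg := (LinearMap.range f).mkQ_surjective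
    obtain ⟨β, rfl⟩ := (exact_extδ_extMap _ hf hfg hg 0 α).1 (ext_eq_zero_of_injective _)
    obtain ⟨e, he⟩ := hg (extEval _ _ β)
    obtain ⟨n, hn⟩ : e ∈ powTorsion 𝔞 E := ht ▸ Submodule.mem_top
    obtain ⟨γ, hγ⟩ := exists_extEval_eq hn
    refine ⟨m + n, Nat.le_add_right m n, ?_⟩
    rw [← extδ_extPowMap]
    refine (exact_extMap_extδ _ hf hfg hg 0 _).2
      ⟨extPowMap 𝔞 _ 0 n (m + n) (Nat.le_add_left n m) γ, extEval_injective ?_⟩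
    rw [extEval_extMap, extEval_extPowMap, extEval_extPowMap, hγ, he]
  | succ i ih =>
    intro X _ _ hX m α
    obtain ⟨E, _, _, f, hE, hf, ht⟩ := exists_injective_module_powTorsion hX
    have hfg := f.exact_map_mkQ_range
    have hg := (LinearMap.range f).mkQ_surjective
    obtain ⟨β, rfl⟩ := (exact_extδ_extMap _ hf hfg hg _ α).1 (ext_eq_zero_of_injective _)
    obtain ⟨n, hn, h⟩ := ih _ (powTorsion_eq_top_of_surjective ht hg) m β
    exact ⟨n, hn, by rw [← extδ_extPowMap, h, map_zero]⟩

variable (𝔞 X) in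
/-- `Ext` and local cohomology of `X ⧸ Γ_𝔞(X)` are shifted versions of those of some module. -/
lemma exists_dimension_shift : ∃ (L : Type u) (_ : AddCommGroup L) (_ : Module R L),
    (∀ i, Nonempty (Abelian.Ext (ModuleCat.of R (R ⧸ 𝔞)) (ModuleCat.of R L) i ≃ₗ[R]
      Abelian.Ext (ModuleCat.of R (R ⧸ 𝔞)) (ModuleCat.of R (X ⧸ powTorsion 𝔞 X)) (i + 1))) ∧
    ∀ i, Nonempty (ExtLimit 𝔞 (ModuleCat.of R L) i ≃ₗ[R]
      ExtLimit 𝔞 (ModuleCat.of R X) (i + 1)) := by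
  obtain ⟨E, _, _, f, hE, hf⟩ := exists_injective_module R X
  have hΓE : Module.Injective R (powTorsion 𝔞 E) := injective_powTorsion
  have hEx := exact_subtype_mkQ (powTorsion 𝔞 E)
  have hvan (J : Ideal R) (n : ℕ) (hJ : 𝔞 ^ n ≤ J) (i : ℕ) (α : Abelian.Ext (ModuleCat.of R (R ⧸ J))
      (ModuleCat.of R (E ⧸ powTorsion 𝔞 E)) i) : α = 0 := by
    cases i with
    | zero =>
      refine extEval_injective ?_
      rw [map_zero, ← Submodule.mem_bot R, ← powTorsion_quotient_powTorsion (𝔞 := 𝔞)]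
      exact ⟨n, fun r hr => smul_extEval (hJ hr) α⟩
    | succ i =>
      exact ext_eq_zero_of_injective_quotient (Submodule.subtype_injective _) hEx
        (Submodule.mkQ_surjective _) α
  let f' : (X ⧸ powTorsion 𝔞 X) →ₗ[R] E ⧸ powTorsion 𝔞 E :=
    Submodule.mapQ _ _ f fun x hx => map_mem_powTorsion f hx
  have hf' : Function.Injective f' := by
    rw [injective_iff_map_eq_zero]
    intro z hz
    obtain ⟨x, rfl⟩ := Submodule.mkQ_surjective _ z
    exact (Submodule.Quotient.mk_eq_zero _).2
      (mem_powTorsion_of_map_mem hf ((Submodule.Quotient.mk_eq_zero _).1 hz))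
  have hfg := f'.exact_map_mkQ_range
  have hg := (LinearMap.range f').mkQ_surjective
  have hbij (J : Ideal R) (n : ℕ) (hJ : 𝔞 ^ n ≤ J) (i : ℕ) :
      Function.Bijective (extδ (ModuleCat.of R (R ⧸ J)) hf' hfg hg i) := by
    refine ⟨(injective_iff_map_eq_zero _).2 fun α hα => ?_, fun α => ?_⟩
    · obtain ⟨β, rfl⟩ := (exact_extMap_extδ _ hf' hfg hg i α).1 hα
      rw [hvan J n hJ i β, map_zero]
    · exact (exact_extδ_extMap _ hf' hfg hg i α).1 (hvan J n hJ _ _)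
  refine ⟨(E ⧸ powTorsion 𝔞 E) ⧸ LinearMap.range f', _, _,
    fun i => ⟨LinearEquiv.ofBijective _ (hbij 𝔞 1 (pow_one 𝔞).le i)⟩, fun i => ?_⟩
  obtain ⟨e₁⟩ := nonempty_extLimit_equiv 𝔞 _ _ i (i + 1) (fun n => extδ _ hf' hfg hg i)
    (fun m n h α => extδ_extPowMap 𝔞 hf' hfg hg i h α)
    (fun n α h => ⟨n, le_rfl, by
      rw [(injective_iff_map_eq_zero _).1 (hbij _ n le_rfl i).1 α h, map_zero]⟩)
    (fun n β => ⟨n, le_rfl, (hbij _ n le_rfl i).2 _⟩)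
  have hΓ := exact_subtype_mkQ (powTorsion 𝔞 X)
  have hi := (powTorsion 𝔞 X).subtype_injective
  have hs := (powTorsion 𝔞 X).mkQ_surjective
  obtain ⟨e₂⟩ := nonempty_extLimit_equiv 𝔞 _ _ (i + 1) (i + 1)
    (fun n => extMap _ (i + 1) (powTorsion 𝔞 X).mkQ)
    (fun m n h α => extMap_extPowMap 𝔞 _ (i + 1) h α)
    (fun n α h => by
      obtain ⟨β, rfl⟩ := (exact_extMap_extMap _ hi hΓ hs (i + 1) α).1 h
      obtain ⟨k, hk, h0⟩ := exists_extPowMap_eq_zero i _ powTorsion_powTorsion n β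
      exact ⟨k, hk, by rw [← extMap_extPowMap, h0, map_zero]⟩)
    (fun n β => by
      obtain ⟨k, hk, h0⟩ := exists_extPowMap_eq_zero (i + 1) _ powTorsion_powTorsion n
        (extδ _ hi hΓ hs (i + 1) β)
      rw [← extδ_extPowMap] at h0
      exact ⟨k, hk, (exact_extMap_extδ _ hi hΓ hs (i + 1) _).1 h0⟩)
  exact ⟨e₁.trans e₂.symm⟩

end ExtLimit

section Main
variable {R : Type u} [CommRing R] {𝔞 : Ideal R} {X Y : Type u} [AddCommGroup X] [Module R X]
  [AddCommGroup Y] [Module R Y]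

lemma IsFDLT.congr {n : ℕ} (h : IsFDLT R n X) (e : X ≃ₗ[R] Y) : IsFDLT R n Y := by
  obtain ⟨N, hN, hd⟩ := h
  refine ⟨N.map e.toLinearMap, hN.map _, ?_⟩
  rwa [← (Submodule.Quotient.equiv N (N.map e.toLinearMap) e rfl).support_eq]

lemma noSupportChain_of_krullDim_lt
    (h : Order.krullDim (Module.support R X) < ((2 : ℕ∞) : WithBot ℕ∞)) : NoSupportChain R X := by
  intro p q r hp hpq hqr
  have hq := Module.mem_support_mono hpq.le hp
  have hr := Module.mem_support_mono hqr.le hq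
  have hlen := Order.LTSeries.length_le_krullDim ((((RelSeries.singleton _ ⟨r, hr⟩ :
    LTSeries (Module.support R X))).cons ⟨q, hq⟩ hqr).cons ⟨p, hp⟩ hpq)
  exact absurd h (not_lt.2 hlen)

lemma finite_ext_iff {N : ModuleCat.{u} R} (i : ℕ) :
    Module.Finite R (((Ext R (ModuleCat.{u} R) i).obj (Opposite.op N)).obj (ModuleCat.of R X)) ↔
      Module.Finite R (Abelian.Ext N (ModuleCat.of R X) i) :=
  Module.Finite.equiv_iff ((projectiveResolution N).extEquiv (ModuleCat.of R X) i)

variable [IsNoetherianRing R]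

lemma extFinite_zero_quotient_powTorsion : ExtFinite 𝔞 0 (X ⧸ powTorsion 𝔞 X) := by
  have : Subsingleton (Abelian.Ext (ModuleCat.of R (R ⧸ 𝔞))
      (ModuleCat.of R (X ⧸ powTorsion 𝔞 X)) 0) := by
    refine subsingleton_of_forall_eq 0 fun α => extEval_injective ?_
    rw [map_zero, ← Submodule.mem_bot R, ← powTorsion_quotient_powTorsion (𝔞 := 𝔞)]
    exact ⟨1, fun r hr => smul_extEval (by rwa [pow_one] at hr) α⟩
  infer_instance

lemma ExtFinite.powTorsion (h : ∀ j, ExtFinite 𝔞 j X) (hΓ : IsFDLT R 2 (powTorsion 𝔞 X))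
    (j : ℕ) : ExtFinite 𝔞 j (powTorsion 𝔞 X) := by
  obtain ⟨N, hN, hd⟩ := hΓ
  have hi := (_root_.powTorsion 𝔞 X).subtype_injective
  exact extFinite_of_quotient_noSupportChain
    (isTorsionIdeal_of_powTorsion_eq_top powTorsion_powTorsion) hN
    (noSupportChain_of_krullDim_lt hd) ((h 0).of_injective hi)
    (extFinite_zero_quotient_powTorsion.left (h 1) hi (exact_subtype_mkQ _)
      (Submodule.mkQ_surjective _)) j

lemma extFinite_extLimit (i : ℕ) : ∀ (X : Type u) [AddCommGroup X] [Module R X]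
    (_ : ∀ j, IsFDLT R 2 (ExtLimit 𝔞 (ModuleCat.of R X) j)) (_ : ∀ j, ExtFinite 𝔞 j X) (j : ℕ),
    ExtFinite 𝔞 j (ExtLimit 𝔞 (ModuleCat.of R X) i) := by
  induction i with
  | zero =>
    intro X _ _ hfd h j
    obtain ⟨e⟩ := nonempty_extLimit_zero_equiv X 𝔞
    exact (ExtFinite.powTorsion h ((hfd 0).congr e) j).congr e.symm
  | succ i ih =>
    intro X _ _ hfd h j
    obtain ⟨e⟩ := nonempty_extLimit_zero_equiv X 𝔞
    have hΓ := ExtFinite.powTorsion h ((hfd 0).congr e)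
    obtain ⟨L, _, _, hE, hL⟩ := exists_dimension_shift X 𝔞
    refine (ih L (fun k => (hfd (k + 1)).congr (hL k).some.symm) (fun k => ?_) j).congr (hL i).some
    have := (h (k + 1)).right (hΓ (k + 2)) (Submodule.subtype_injective _)
      (exact_subtype_mkQ (powTorsion 𝔞 X)) (Submodule.mkQ_surjective _)
    exact Module.Finite.equiv (hE k).some.symm

lemma extFinite_of_extLimit (i : ℕ) : ∀ (X : Type u) [AddCommGroup X] [Module R X]
    (_ : ∀ k j, ExtFinite 𝔞 j (ExtLimit 𝔞 (ModuleCat.of R X) k)), ExtFinite 𝔞 i X := by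
  induction i with
  | zero =>
    intro X _ _ h
    obtain ⟨e⟩ := nonempty_extLimit_zero_equiv X 𝔞
    exact ((h 0 0).congr e).middle extFinite_zero_quotient_powTorsion
      (Submodule.subtype_injective _) (exact_subtype_mkQ _) (Submodule.mkQ_surjective _)
  | succ i ih =>
    intro X _ _ h
    obtain ⟨e⟩ := nonempty_extLimit_zero_equiv X 𝔞
    obtain ⟨L, _, _, hE, hL⟩ := exists_dimension_shift X 𝔞
    have := ih L fun k j => (h (k + 1) j).congr (hL k).some.symm
    exact ((h 0 (i + 1)).congr e).middle (Module.Finite.equiv (hE i).some)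
      (Submodule.subtype_injective _) (exact_subtype_mkQ _) (Submodule.mkQ_surjective _)

end Main

/-- Corollary 3.3: if all `H^i_𝔞(M)` are `FD_{<2}`, then all `Ext^i_R(R/𝔞, M)` are finite
iff all `H^i_𝔞(M)` are `𝔞`-cofinite. -/
theorem localCohomology_isCofinite_iff_ext_finite_of_isFDLT_two
    (R : Type u) [CommRing R] [IsNoetherianRing R] (𝔞 : Ideal R)
    (M : Type u) [AddCommGroup M] [Module R M]
    (hfd : ∀ i : ℕ, IsFDLT R 2 (localCohomologyModule R 𝔞 M i)) :
    (∀ i : ℕ, Module.Finite R (extModule R (R ⧸ 𝔞) M i)) ↔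
      (∀ i : ℕ, IsCofinite R 𝔞 (localCohomologyModule R 𝔞 M i)) := by
  let e (i : ℕ) : localCohomologyModule R 𝔞 M i ≃ₗ[R] ExtLimit 𝔞 (ModuleCat.of R M) i :=
    (nonempty_linearEquiv_extLimit 𝔞 (ModuleCat.of R M) i).some
  have hsupp (i : ℕ) : Module.support R (localCohomologyModule R 𝔞 M i) ⊆
      PrimeSpectrum.zeroLocus (𝔞 : Set R) := by
    rw [(e i).support_eq]
    exact (isTorsionIdeal_of_powTorsion_eq_top (powTorsion_extLimit 𝔞 _ i)).support_subset
  constructor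
  · refine fun h i => ⟨hsupp i, fun j => (finite_ext_iff j).2 ?_⟩
    exact (extFinite_extLimit i M (fun k => (hfd k).congr (e k))
      (fun k => (finite_ext_iff k).1 (h k)) j).congr (e i).symm
  · refine fun h i => (finite_ext_iff i).2 (extFinite_of_extLimit i M fun k j => ?_)
    exact ExtFinite.congr ((finite_ext_iff j).1 ((h k).2 j)) (e k)
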